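/- Suppose the parameter-dependent boundary-value problem L(ε)y = f(·,ε), B(ε)y = c(ε) satisfies Condition (0) and Limit Conditions (I) and (II). Then its solution depends continuously on the parameter ε at ε = 0: (∗) there exists ε₁ ∈ (0, ε₀) such that for every ε ∈ [0, ε₁) and arbitrary f(·,ε) ∈ (C^{n,α})^m and c(ε) ∈ ℂ^{rm} the problem has a unique solution y(·,ε) ∈ (C^{n+r,α})^m; and (∗∗) whenever Limit Conditions (III) and (IV) hold, y(·,ε) → y(·,0) in (C^{n+r,α})^m as ε → 0+. -/

import Mathlib

open Set Filter Topology

noncomputable section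

/-- `x` belongs to the Hölder space `C^{n,α}([a,b],ℂ)`: it is `n` times continuously
differentiable on `[a,b]` and the Hölder seminorm of `x⁽ⁿ⁾` is finite. -/
def HolMem (a b : ℝ) (n : ℕ) (α : ℝ) (x : ℝ → ℂ) : Prop :=
  ContDiffOn ℝ n x (Set.Icc a b) ∧
    ∃ C : ℝ, ∀ t₁ ∈ Set.Icc a b, ∀ t₂ ∈ Set.Icc a b, t₁ < t₂ →
      ‖iteratedDerivWithin n x (Set.Icc a b) t₂ - iteratedDerivWithin n x (Set.Icc a b) t₁‖ ≤
        C * (t₂ - t₁) ^ α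

/-- The Hölder seminorm `‖x‖'_{n,α}`. -/
def holSemiNorm (a b : ℝ) (n : ℕ) (α : ℝ) (x : ℝ → ℂ) : ℝ :=
  sSup { s : ℝ | ∃ t₁ ∈ Set.Icc a b, ∃ t₂ ∈ Set.Icc a b, t₁ < t₂ ∧
    s = ‖iteratedDerivWithin n x (Set.Icc a b) t₂ - iteratedDerivWithin n x (Set.Icc a b) t₁‖ /
        (t₂ - t₁) ^ α }

/-- The Hölder norm `‖x‖_{n,α} = ∑_{j=0}^n max_{[a,b]} |x⁽ʲ⁾| + ‖x‖'_{n,α}`. -/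
def holNorm (a b : ℝ) (n : ℕ) (α : ℝ) (x : ℝ → ℂ) : ℝ :=
  (∑ j ∈ Finset.range (n + 1),
      sSup { s : ℝ | ∃ t ∈ Set.Icc a b, s = ‖iteratedDerivWithin j x (Set.Icc a b) t‖ }) +
    holSemiNorm a b n α x

/-- Vector-valued Hölder class `(C^{n,α})^k`. -/
def vHolMem (a b : ℝ) (n : ℕ) (α : ℝ) {k : ℕ} (x : ℝ → (Fin k → ℂ)) : Prop :=
  ∀ i, HolMem a b n α (fun t => x t i)

/-- Norm on `(C^{n,α})^k`: the sum of the norms of the entries. -/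
def vHolNorm (a b : ℝ) (n : ℕ) (α : ℝ) {k : ℕ} (x : ℝ → (Fin k → ℂ)) : ℝ :=
  ∑ i, holNorm a b n α (fun t => x t i)

/-- Matrix-valued Hölder class `(C^{n,α})^{k×l}`. -/
def mHolMem (a b : ℝ) (n : ℕ) (α : ℝ) {k l : ℕ} (X : ℝ → Matrix (Fin k) (Fin l) ℂ) : Prop :=
  ∀ i j, HolMem a b n α (fun t => X t i j)

/-- Norm on `(C^{n,α})^{k×l}`: the sum of the norms of the entries. -/
def mHolNorm (a b : ℝ) (n : ℕ) (α : ℝ) {k l : ℕ} (X : ℝ → Matrix (Fin k) (Fin l) ℂ) : ℝ :=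
  ∑ i, ∑ j, holNorm a b n α (fun t => X t i j)

/-- Entrywise `p`-th derivative of a vector-valued function on `[a,b]`. -/
def vDeriv (a b : ℝ) (p : ℕ) {k : ℕ} (y : ℝ → (Fin k → ℂ)) : ℝ → (Fin k → ℂ) :=
  fun t i => iteratedDerivWithin p (fun s => y s i) (Set.Icc a b) t

/-- Entrywise `p`-th derivative of a matrix-valued function on `[a,b]`. -/
def mDeriv (a b : ℝ) (p : ℕ) {k l : ℕ} (Y : ℝ → Matrix (Fin k) (Fin l) ℂ) :
    ℝ → Matrix (Fin k) (Fin l) ℂ :=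
  fun t i j => iteratedDerivWithin p (fun s => Y s i j) (Set.Icc a b) t

/-- The differential expression `(L y)(t) = y⁽ʳ⁾(t) + ∑_{j=1}^r A_{r-j}(t) y⁽ʳ⁻ʲ⁾(t)`;
here `A j` denotes the coefficient matrix of `y⁽ʲ⁾`, for `0 ≤ j ≤ r-1`. -/
def Lop (a b : ℝ) (r : ℕ) {m : ℕ} (A : Fin r → ℝ → Matrix (Fin m) (Fin m) ℂ)
    (y : ℝ → (Fin m → ℂ)) : ℝ → (Fin m → ℂ) :=
  fun t => vDeriv a b r y t + ∑ j : Fin r, (A j t).mulVec (vDeriv a b (j : ℕ) y t)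

/-- The matrix analogue of `Lop`, applied to matrix-valued functions. -/
def LopM (a b : ℝ) (r : ℕ) {m k : ℕ} (A : Fin r → ℝ → Matrix (Fin m) (Fin m) ℂ)
    (Z : ℝ → Matrix (Fin m) (Fin k) ℂ) : ℝ → Matrix (Fin m) (Fin k) ℂ :=
  fun t => mDeriv a b r Z t + ∑ j : Fin r, A j t * mDeriv a b (j : ℕ) Z t

/-- `y` is a solution in `(C^{n+r,α})^m` of the problem `L y = f` on `[a,b]`, `B y = c`. -/
def IsSol (a b : ℝ) (n : ℕ) (α : ℝ) (r m : ℕ)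
    (A : Fin r → ℝ → Matrix (Fin m) (Fin m) ℂ)
    (B : (ℝ → (Fin m → ℂ)) →ₗ[ℂ] (Fin (r * m) → ℂ))
    (f : ℝ → (Fin m → ℂ)) (c : Fin (r * m) → ℂ) (y : ℝ → (Fin m → ℂ)) : Prop :=
  vHolMem a b (n + r) α y ∧ (∀ t ∈ Set.Icc a b, Lop a b r A y t = f t) ∧ B y = c

/-- Limit Condition (I): `A_{r-j}(·,ε) → A_{r-j}(·,0)` in `(C^{n,α})^{m×m}` as `ε → 0+`. -/
def CondI (a b : ℝ) (n : ℕ) (α : ℝ) (r m : ℕ)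
    (A : ℝ → Fin r → ℝ → Matrix (Fin m) (Fin m) ℂ) : Prop :=
  ∀ j : Fin r,
    Tendsto (fun ε => mHolNorm a b n α (fun t => A ε j t - A 0 j t))
      (nhdsWithin 0 (Set.Ioi 0)) (nhds 0)

/-- Limit Condition (II): `B(ε)y → B(0)y` in `ℂ^{rm}` as `ε → 0+`,
for every `y ∈ (C^{n+r,α})^m`. -/
def CondII (a b : ℝ) (n : ℕ) (α : ℝ) (r m : ℕ)
    (B : ℝ → (ℝ → (Fin m → ℂ)) →ₗ[ℂ] (Fin (r * m) → ℂ)) : Prop :=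
  ∀ y : ℝ → (Fin m → ℂ), vHolMem a b (n + r) α y →
    Tendsto (fun ε => B ε y) (nhdsWithin 0 (Set.Ioi 0)) (nhds (B 0 y))

/-- Condition (0): the homogeneous problem `L(0)y = 0`, `B(0)y = 0` has only the
trivial solution in `(C^{n+r,α})^m`. -/
def Cond0 (a b : ℝ) (n : ℕ) (α : ℝ) (r m : ℕ)
    (A : Fin r → ℝ → Matrix (Fin m) (Fin m) ℂ)
    (B : (ℝ → (Fin m → ℂ)) →ₗ[ℂ] (Fin (r * m) → ℂ)) : Prop :=
  ∀ y : ℝ → (Fin m → ℂ), vHolMem a b (n + r) α y →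
    (∀ t ∈ Set.Icc a b, Lop a b r A y t = 0) → B y = 0 →
    ∀ t ∈ Set.Icc a b, y t = 0

/-- Condition (∗): for every `ε ∈ [0,ε₁)` and arbitrary data `f ∈ (C^{n,α})^m`, `c ∈ ℂ^{rm}`,
the problem `L(ε)y = f`, `B(ε)y = c` has a unique solution `y ∈ (C^{n+r,α})^m`
(uniqueness is understood as equality on `[a,b]`). -/
def CondStar (a b : ℝ) (n : ℕ) (α : ℝ) (r m : ℕ) (ε₁ : ℝ)
    (A : ℝ → Fin r → ℝ → Matrix (Fin m) (Fin m) ℂ)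
    (B : ℝ → (ℝ → (Fin m → ℂ)) →ₗ[ℂ] (Fin (r * m) → ℂ)) : Prop :=
  ∀ ε ∈ Set.Ico (0 : ℝ) ε₁, ∀ f : ℝ → (Fin m → ℂ), vHolMem a b n α f →
    ∀ c : Fin (r * m) → ℂ,
      ∃ y, IsSol a b n α r m (A ε) (B ε) f c y ∧
        ∀ y', IsSol a b n α r m (A ε) (B ε) f c y' → Set.EqOn y' y (Set.Icc a b)

/-- Condition (∗∗): if `f(·,ε) → f(·,0)` in `(C^{n,α})^m` and `c(ε) → c(0)` in `ℂ^{rm}`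
as `ε → 0+`, then the solutions satisfy `y(·,ε) → y(·,0)` in `(C^{n+r,α})^m`. -/
def CondStarStar (a b : ℝ) (n : ℕ) (α : ℝ) (r m : ℕ) (ε₁ : ℝ)
    (A : ℝ → Fin r → ℝ → Matrix (Fin m) (Fin m) ℂ)
    (B : ℝ → (ℝ → (Fin m → ℂ)) →ₗ[ℂ] (Fin (r * m) → ℂ)) : Prop :=
  ∀ (f : ℝ → ℝ → (Fin m → ℂ)) (c : ℝ → Fin (r * m) → ℂ) (y : ℝ → ℝ → (Fin m → ℂ)),
    (∀ ε ∈ Set.Ico (0 : ℝ) ε₁, vHolMem a b n α (f ε) ∧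
      IsSol a b n α r m (A ε) (B ε) (f ε) (c ε) (y ε)) →
    Tendsto (fun ε => vHolNorm a b n α (fun t => f ε t - f 0 t))
      (nhdsWithin 0 (Set.Ioi 0)) (nhds 0) →
    Tendsto c (nhdsWithin 0 (Set.Ioi 0)) (nhds (c 0)) →
    Tendsto (fun ε => vHolNorm a b (n + r) α (fun t => y ε t - y 0 t))
      (nhdsWithin 0 (Set.Ioi 0)) (nhds 0)


def hSup (a b : ℝ) (x : ℝ → ℂ) : ℝ := sSup { s : ℝ | ∃ t ∈ Set.Icc a b, s = ‖x t‖ }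

lemma hSup_le {a b : ℝ} (hab : a < b) {x : ℝ → ℂ} {C : ℝ} (h : ∀ t ∈ Icc a b, ‖x t‖ ≤ C) :
    hSup a b x ≤ C := by
  apply csSup_le
  · exact ⟨_, a, ⟨le_refl _, hab.le⟩, rfl⟩
  · rintro s ⟨t, ht, rfl⟩
    exact h t ht

lemma le_hSup {a b : ℝ} {x : ℝ → ℂ} (hx : ContinuousOn x (Icc a b)) {t : ℝ} (ht : t ∈ Icc a b) :
    ‖x t‖ ≤ hSup a b x := by
  apply le_csSup
  · obtain ⟨C, hC⟩ := isCompact_Icc.exists_bound_of_continuousOn hx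
    refine ⟨C, ?_⟩
    rintro s ⟨t, ht, rfl⟩
    exact hC t ht
  · exact ⟨t, ht, rfl⟩

lemma hSup_nonneg (a b : ℝ) (x : ℝ → ℂ) : 0 ≤ hSup a b x := by
  apply Real.sSup_nonneg
  rintro s ⟨t, ht, rfl⟩
  exact norm_nonneg _

lemma hSup_congr {a b : ℝ} {x y : ℝ → ℂ} (h : EqOn x y (Icc a b)) : hSup a b x = hSup a b y := by
  unfold hSup
  congr 1
  ext s
  constructor
  · rintro ⟨t, ht, rfl⟩
    exact ⟨t, ht, by rw [h ht]⟩
  · rintro ⟨t, ht, rfl⟩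
    exact ⟨t, ht, by rw [h ht]⟩

lemma holSemi_nonneg (a b : ℝ) (n : ℕ) (α : ℝ) (x : ℝ → ℂ) : 0 ≤ holSemiNorm a b n α x := by
  apply Real.sSup_nonneg
  rintro s ⟨t₁, h₁, t₂, h₂, h, rfl⟩
  have : 0 ≤ t₂ - t₁ := by linarith
  positivity

lemma holSemi_le {a b : ℝ} (hab : a < b) {α : ℝ} {x : ℝ → ℂ} {C : ℝ}
    (h : ∀ t₁ ∈ Icc a b, ∀ t₂ ∈ Icc a b, t₁ < t₂ → ‖x t₂ - x t₁‖ ≤ C * (t₂ - t₁) ^ α) :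
    holSemiNorm a b 0 α x ≤ C := by
  apply csSup_le
  · exact ⟨_, a, ⟨le_refl _, hab.le⟩, b, ⟨hab.le, le_refl _⟩, hab, rfl⟩
  · rintro s ⟨t₁, h₁, t₂, h₂, h12, rfl⟩
    have : 0 < t₂ - t₁ := by linarith
    rw [div_le_iff₀ (by positivity)]
    simpa using h t₁ h₁ t₂ h₂ h12

lemma le_holSemi {a b : ℝ} {α : ℝ} {x : ℝ → ℂ} (hx : HolMem a b 0 α x) {t₁ t₂ : ℝ}
    (h₁ : t₁ ∈ Icc a b) (h₂ : t₂ ∈ Icc a b) (h12 : t₁ < t₂) :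
    ‖x t₂ - x t₁‖ ≤ holSemiNorm a b 0 α x * (t₂ - t₁) ^ α := by
  have h0 : 0 < t₂ - t₁ := by linarith
  rw [← div_le_iff₀ (by positivity)]
  apply le_csSup
  · obtain ⟨C, hC⟩ := hx.2
    refine ⟨C, ?_⟩
    rintro s ⟨t₁, h₁, t₂, h₂, h12, rfl⟩
    have : 0 < t₂ - t₁ := by linarith
    rw [div_le_iff₀ (by positivity)]
    exact hC t₁ h₁ t₂ h₂ h12
  · exact ⟨t₁, h₁, t₂, h₂, h12, by simp⟩

lemma holMem_zero_iff {a b α : ℝ} {x : ℝ → ℂ} : HolMem a b 0 α x ↔ ContinuousOn x (Icc a b) ∧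
    ∃ C : ℝ, ∀ t₁ ∈ Icc a b, ∀ t₂ ∈ Icc a b, t₁ < t₂ → ‖x t₂ - x t₁‖ ≤ C * (t₂ - t₁) ^ α := by
  unfold HolMem
  simp

lemma holNorm_zero (a b α : ℝ) (x : ℝ → ℂ) :
    holNorm a b 0 α x = hSup a b x + holSemiNorm a b 0 α x := by
  simp [holNorm, hSup]

lemma holMem_succ_iff {a b α : ℝ} (hab : a < b) {n : ℕ} {x : ℝ → ℂ} :
    HolMem a b (n + 1) α x ↔ DifferentiableOn ℝ x (Icc a b) ∧
      HolMem a b n α (derivWithin x (Icc a b)) := by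
  unfold HolMem
  simp only [iteratedDerivWithin_succ']
  push_cast
  rw [contDiffOn_succ_iff_derivWithin (uniqueDiffOn_Icc hab)]
  simp [and_assoc]

lemma holNorm_succ (a b α : ℝ) (n : ℕ) (x : ℝ → ℂ) :
    holNorm a b (n + 1) α x = hSup a b x + holNorm a b n α (derivWithin x (Icc a b)) := by
  unfold holNorm holSemiNorm hSup
  rw [Finset.sum_range_succ' _ (n + 1)]
  simp only [iteratedDerivWithin_succ', iteratedDerivWithin_zero]
  ring

lemma HolMem.continuousOn {a b α : ℝ} {n : ℕ} {x : ℝ → ℂ} (h : HolMem a b n α x) :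
    ContinuousOn x (Icc a b) := h.1.continuousOn

lemma holNorm_nonneg (a b : ℝ) (n : ℕ) (α : ℝ) (x : ℝ → ℂ) : 0 ≤ holNorm a b n α x := by
  induction n generalizing x with
  | zero => rw [holNorm_zero]; exact add_nonneg (hSup_nonneg _ _ _) (holSemi_nonneg _ _ _ _ _)
  | succ n ih => rw [holNorm_succ]; exact add_nonneg (hSup_nonneg _ _ _) (ih _)

lemma hSup_le_holNorm (a b : ℝ) (n : ℕ) (α : ℝ) (x : ℝ → ℂ) : hSup a b x ≤ holNorm a b n α x := by
  cases n with
  | zero => rw [holNorm_zero]; linarith [holSemi_nonneg a b 0 α x]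
  | succ n => rw [holNorm_succ]; linarith [holNorm_nonneg a b n α (derivWithin x (Icc a b))]

lemma norm_le_holNorm {a b : ℝ} {n : ℕ} {α : ℝ} {x : ℝ → ℂ} (h : HolMem a b n α x) {t : ℝ}
    (ht : t ∈ Icc a b) : ‖x t‖ ≤ holNorm a b n α x :=
  (le_hSup h.continuousOn ht).trans (hSup_le_holNorm _ _ _ _ _)

lemma HolMem.congr {a b : ℝ} {n : ℕ} {α : ℝ} {x y : ℝ → ℂ} (h : HolMem a b n α x)
    (he : EqOn x y (Icc a b)) : HolMem a b n α y := by
  refine ⟨h.1.congr (fun t ht => (he ht).symm), ?_⟩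
  obtain ⟨C, hC⟩ := h.2
  refine ⟨C, fun t₁ h₁ t₂ h₂ h12 => ?_⟩
  rw [← iteratedDerivWithin_congr he h₁, ← iteratedDerivWithin_congr he h₂]
  exact hC t₁ h₁ t₂ h₂ h12

lemma holSemi_congr {a b : ℝ} {α : ℝ} {x y : ℝ → ℂ} (h : EqOn x y (Icc a b)) :
    holSemiNorm a b 0 α x = holSemiNorm a b 0 α y := by
  unfold holSemiNorm
  congr 1
  ext s
  simp only [iteratedDerivWithin_zero]
  constructor
  · rintro ⟨t, ht, u, hu, h1, rfl⟩
    exact ⟨t, ht, u, hu, h1, by rw [h ht, h hu]⟩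
  · rintro ⟨t, ht, u, hu, h1, rfl⟩
    exact ⟨t, ht, u, hu, h1, by rw [h ht, h hu]⟩

lemma holNorm_congr {a b : ℝ} {n : ℕ} {α : ℝ} {x y : ℝ → ℂ} (h : EqOn x y (Icc a b)) :
    holNorm a b n α x = holNorm a b n α y := by
  induction n generalizing x y with
  | zero => rw [holNorm_zero, holNorm_zero, hSup_congr h, holSemi_congr h]
  | succ n ih =>
    rw [holNorm_succ, holNorm_succ, hSup_congr h, ih]
    intro t ht
    exact derivWithin_congr h (h ht)

lemma HolMem.zero_fun (a b : ℝ) (n : ℕ) (α : ℝ) : HolMem a b n α (fun _ => 0) := by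
  refine ⟨contDiffOn_const, 0, fun t₁ h₁ t₂ h₂ h12 => ?_⟩
  simp

lemma HolMem.add {a b : ℝ} (hab : a < b) {n : ℕ} {α : ℝ} {x y : ℝ → ℂ} (hx : HolMem a b n α x)
    (hy : HolMem a b n α y) : HolMem a b n α (fun t => x t + y t) ∧
      holNorm a b n α (fun t => x t + y t) ≤ holNorm a b n α x + holNorm a b n α y := by
  have hsup : ∀ {x y : ℝ → ℂ}, ContinuousOn x (Icc a b) → ContinuousOn y (Icc a b) →
      hSup a b (fun t => x t + y t) ≤ hSup a b x + hSup a b y := fun hx hy =>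
    hSup_le hab fun t ht => (norm_add_le _ _).trans (add_le_add (le_hSup hx ht) (le_hSup hy ht))
  induction n generalizing x y with
  | zero =>
    have key : ∀ t₁ ∈ Icc a b, ∀ t₂ ∈ Icc a b, t₁ < t₂ → ‖x t₂ + y t₂ - (x t₁ + y t₁)‖ ≤
        (holSemiNorm a b 0 α x + holSemiNorm a b 0 α y) * (t₂ - t₁) ^ α := by
      intro t₁ h₁ t₂ h₂ h12
      have e : x t₂ + y t₂ - (x t₁ + y t₁) = (x t₂ - x t₁) + (y t₂ - y t₁) := by ring
      rw [e, add_mul]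
      exact (norm_add_le _ _).trans (add_le_add (le_holSemi hx h₁ h₂ h12) (le_holSemi hy h₁ h₂ h12))
    refine ⟨holMem_zero_iff.2 ⟨hx.continuousOn.add hy.continuousOn, _, key⟩, ?_⟩
    rw [holNorm_zero, holNorm_zero, holNorm_zero]
    linarith [hsup hx.continuousOn hy.continuousOn, holSemi_le hab key]
  | succ n ih =>
    have hx' := (holMem_succ_iff hab).1 hx
    have hy' := (holMem_succ_iff hab).1 hy
    have he : EqOn (fun t => derivWithin x (Icc a b) t + derivWithin y (Icc a b) t)
        (derivWithin (fun t => x t + y t) (Icc a b)) (Icc a b) := fun t ht =>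
      (derivWithin_fun_add (hx'.1 t ht) (hy'.1 t ht)).symm
    have := ih hx'.2 hy'.2
    refine ⟨(holMem_succ_iff hab).2 ⟨hx'.1.add hy'.1, this.1.congr he⟩, ?_⟩
    rw [holNorm_succ, holNorm_succ, holNorm_succ, ← holNorm_congr he]
    linarith [hsup hx.continuousOn hy.continuousOn, this.2]

lemma HolMem.smul {a b : ℝ} (hab : a < b) {n : ℕ} {α : ℝ} {x : ℝ → ℂ} (hx : HolMem a b n α x)
    (c : ℂ) : HolMem a b n α (fun t => c * x t) ∧
      holNorm a b n α (fun t => c * x t) ≤ ‖c‖ * holNorm a b n α x := by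
  have hsup : ∀ {x : ℝ → ℂ}, ContinuousOn x (Icc a b) →
      hSup a b (fun t => c * x t) ≤ ‖c‖ * hSup a b x := fun hx =>
    hSup_le hab fun t ht => by
      rw [norm_mul]
      exact mul_le_mul_of_nonneg_left (le_hSup hx ht) (norm_nonneg _)
  induction n generalizing x with
  | zero =>
    have key : ∀ t₁ ∈ Icc a b, ∀ t₂ ∈ Icc a b, t₁ < t₂ → ‖c * x t₂ - c * x t₁‖ ≤
        (‖c‖ * holSemiNorm a b 0 α x) * (t₂ - t₁) ^ α := by
      intro t₁ h₁ t₂ h₂ h12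
      rw [← mul_sub, norm_mul, mul_assoc]
      exact mul_le_mul_of_nonneg_left (le_holSemi hx h₁ h₂ h12) (norm_nonneg _)
    refine ⟨holMem_zero_iff.2 ⟨continuousOn_const.mul hx.continuousOn, _, key⟩, ?_⟩
    rw [holNorm_zero, holNorm_zero]
    linarith [hsup hx.continuousOn, holSemi_le hab key]
  | succ n ih =>
    have hx' := (holMem_succ_iff hab).1 hx
    have he : EqOn (fun t => c * derivWithin x (Icc a b) t)
        (derivWithin (fun t => c * x t) (Icc a b)) (Icc a b) := fun t ht =>
      (derivWithin_const_mul c (hx'.1 t ht)).symm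
    have := ih hx'.2
    refine ⟨(holMem_succ_iff hab).2 ⟨hx'.1.const_mul c, this.1.congr he⟩, ?_⟩
    rw [holNorm_succ, holNorm_succ, ← holNorm_congr he]
    linarith [hsup hx.continuousOn, this.2]

lemma HolMem.norm_smul {a b : ℝ} (hab : a < b) {n : ℕ} {α : ℝ} {x : ℝ → ℂ} (hx : HolMem a b n α x)
    (c : ℂ) : holNorm a b n α (fun t => c * x t) = ‖c‖ * holNorm a b n α x := by
  apply le_antisymm (hx.smul hab c).2
  by_cases hc : c = 0
  · subst hc
    simpa using holNorm_nonneg _ _ _ _ _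
  · have := ((hx.smul hab c).1.smul hab c⁻¹).2
    simp only [inv_mul_cancel_left₀ hc, norm_inv] at this
    rwa [← le_inv_mul_iff₀ (norm_pos_iff.2 hc)]

lemma HolMem.sub {a b : ℝ} (hab : a < b) {n : ℕ} {α : ℝ} {x y : ℝ → ℂ} (hx : HolMem a b n α x)
    (hy : HolMem a b n α y) : HolMem a b n α (fun t => x t - y t) ∧
      holNorm a b n α (fun t => x t - y t) ≤ holNorm a b n α x + holNorm a b n α y := by
  have h := hx.add hab (hy.smul hab (-1)).1
  have h2 := hy.norm_smul hab (-1)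
  simp only [neg_mul, one_mul, ← sub_eq_add_neg, norm_neg, norm_one] at h h2
  rw [h2] at h
  exact h

lemma HolMem.sum {a b : ℝ} (hab : a < b) {n : ℕ} {α : ℝ} {ι : Type*} (s : Finset ι)
    {x : ι → ℝ → ℂ} (hx : ∀ i ∈ s, HolMem a b n α (x i)) :
    HolMem a b n α (fun t => ∑ i ∈ s, x i t) ∧
      holNorm a b n α (fun t => ∑ i ∈ s, x i t) ≤ ∑ i ∈ s, holNorm a b n α (x i) := by
  classical
  induction s using Finset.induction_on with
  | empty =>
    simp only [Finset.sum_empty]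
    refine ⟨HolMem.zero_fun _ _ _ _, ?_⟩
    have := (HolMem.zero_fun a b n α).norm_smul hab 0
    simp at this
    exact this.le
  | insert i s hi ih =>
    simp only [Finset.sum_insert hi]
    have h1 := ih fun j hj => hx j (Finset.mem_insert_of_mem hj)
    have h2 := (hx i (Finset.mem_insert_self _ _)).add hab h1.1
    exact ⟨h2.1, h2.2.trans (by linarith [h1.2])⟩

/-- The embedding of continuously differentiable functions into the Hölder class. -/
lemma holMem_zero_of_deriv {a b : ℝ} (hab : a < b) {α : ℝ} (hα1 : α ≤ 1) {x : ℝ → ℂ}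
    {D : ℝ} (hx : DifferentiableOn ℝ x (Icc a b))
    (hD : ∀ t ∈ Icc a b, ‖derivWithin x (Icc a b) t‖ ≤ D) :
    HolMem a b 0 α x ∧ holNorm a b 0 α x ≤ hSup a b x + (b - a) ^ (1 - α) * D := by
  have hD0 : 0 ≤ D := (norm_nonneg _).trans (hD a ⟨le_refl _, hab.le⟩)
  have key : ∀ t₁ ∈ Icc a b, ∀ t₂ ∈ Icc a b, t₁ < t₂ → ‖x t₂ - x t₁‖ ≤
      ((b - a) ^ (1 - α) * D) * (t₂ - t₁) ^ α := by
    intro t₁ h₁ t₂ h₂ h12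
    have h := (convex_Icc a b).norm_image_sub_le_of_norm_derivWithin_le hx hD h₁ h₂
    have h0 : 0 < t₂ - t₁ := by linarith
    have e : t₂ - t₁ = (t₂ - t₁) ^ (1 - α) * (t₂ - t₁) ^ α := by
      rw [← Real.rpow_add h0]; simp
    rw [Real.norm_eq_abs, abs_of_pos h0, e] at h
    refine h.trans ?_
    rw [mul_comm ((b - a) ^ (1 - α)) D, mul_assoc]
    have : t₂ - t₁ ≤ b - a := by linarith [h₁.1, h₂.2]
    have h1α : 0 ≤ 1 - α := by linarith
    gcongr
  refine ⟨holMem_zero_iff.2 ⟨hx.continuousOn, _, key⟩, ?_⟩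
  rw [holNorm_zero]
  linarith [holSemi_le hab key]

lemma HolMem.of_succ {a b : ℝ} (hab : a < b) {α : ℝ} (hα1 : α ≤ 1) (n : ℕ) :
    ∃ C : ℝ, 0 ≤ C ∧ ∀ x : ℝ → ℂ, HolMem a b (n + 1) α x →
      HolMem a b n α x ∧ holNorm a b n α x ≤ C * holNorm a b (n + 1) α x := by
  induction n with
  | zero =>
    refine ⟨1 + (b - a) ^ (1 - α), ?_, fun x hx => ?_⟩
    · have : 0 < b - a := by linarith
      positivity
    · have hx' := (holMem_succ_iff hab).1 hx
      have h := holMem_zero_of_deriv hab hα1 hx'.1 (fun t ht => le_hSup hx'.2.continuousOn ht)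
      refine ⟨h.1, h.2.trans ?_⟩
      rw [holNorm_succ, holNorm_zero]
      have h1 := hSup_nonneg a b x
      have h2 := hSup_nonneg a b (derivWithin x (Icc a b))
      have h3 := holSemi_nonneg a b 0 α (derivWithin x (Icc a b))
      have h4 : 0 ≤ (b - a) ^ (1 - α) := by
        have : 0 < b - a := by linarith
        positivity
      nlinarith [mul_nonneg h4 h1, mul_nonneg h4 h2, mul_nonneg h4 h3]
  | succ n ih =>
    obtain ⟨C, hC0, hC⟩ := ih
    refine ⟨1 + C, by positivity, fun x hx => ?_⟩
    have hx' := (holMem_succ_iff hab).1 hx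
    have h := hC _ hx'.2
    refine ⟨(holMem_succ_iff hab).2 ⟨hx'.1, h.1⟩, ?_⟩
    rw [holNorm_succ, holNorm_succ a b α (n + 1)]
    have h1 := hSup_nonneg a b x
    have h2 := holNorm_nonneg a b (n + 1) α (derivWithin x (Icc a b))
    nlinarith [mul_nonneg hC0 h1, h.2]

lemma HolMem.of_le {a b : ℝ} (hab : a < b) {α : ℝ} (hα1 : α ≤ 1) {k n : ℕ} (hkn : k ≤ n) :
    ∃ C : ℝ, 0 ≤ C ∧ ∀ x : ℝ → ℂ, HolMem a b n α x →
      HolMem a b k α x ∧ holNorm a b k α x ≤ C * holNorm a b n α x := by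
  induction n, hkn using Nat.le_induction with
  | base => exact ⟨1, zero_le_one, fun x hx => ⟨hx, by simp⟩⟩
  | succ n hkn ih =>
    obtain ⟨C, hC0, hC⟩ := ih
    obtain ⟨D, hD0, hD⟩ := HolMem.of_succ hab hα1 n
    refine ⟨C * D, by positivity, fun x hx => ?_⟩
    have h1 := hD x hx
    have h2 := hC x h1.1
    refine ⟨h2.1, h2.2.trans ?_⟩
    rw [mul_assoc]
    exact mul_le_mul_of_nonneg_left h1.2 hC0

lemma HolMem.mul {a b : ℝ} (hab : a < b) {α : ℝ} (hα1 : α ≤ 1) (n : ℕ) :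
    ∃ C : ℝ, 0 ≤ C ∧ ∀ x y : ℝ → ℂ, HolMem a b n α x → HolMem a b n α y →
      HolMem a b n α (fun t => x t * y t) ∧
        holNorm a b n α (fun t => x t * y t) ≤ C * holNorm a b n α x * holNorm a b n α y := by
  have hsup : ∀ {x y : ℝ → ℂ}, ContinuousOn x (Icc a b) → ContinuousOn y (Icc a b) →
      hSup a b (fun t => x t * y t) ≤ hSup a b x * hSup a b y := fun hx hy =>
    hSup_le hab fun t ht => by
      rw [norm_mul]
      exact mul_le_mul (le_hSup hx ht) (le_hSup hy ht) (norm_nonneg _) (hSup_nonneg _ _ _)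
  induction n with
  | zero =>
    refine ⟨1, zero_le_one, fun x y hx hy => ?_⟩
    have key : ∀ t₁ ∈ Icc a b, ∀ t₂ ∈ Icc a b, t₁ < t₂ → ‖x t₂ * y t₂ - x t₁ * y t₁‖ ≤
        (hSup a b x * holSemiNorm a b 0 α y + hSup a b y * holSemiNorm a b 0 α x) *
          (t₂ - t₁) ^ α := by
      intro t₁ h₁ t₂ h₂ h12
      have e : x t₂ * y t₂ - x t₁ * y t₁ = x t₂ * (y t₂ - y t₁) + y t₁ * (x t₂ - x t₁) := by ring
      rw [e, add_mul, mul_assoc, mul_assoc]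
      refine (norm_add_le _ _).trans ?_
      rw [norm_mul, norm_mul]
      exact add_le_add
        (mul_le_mul (le_hSup hx.continuousOn h₂) (le_holSemi hy h₁ h₂ h12) (norm_nonneg _)
          (hSup_nonneg _ _ _))
        (mul_le_mul (le_hSup hy.continuousOn h₁) (le_holSemi hx h₁ h₂ h12) (norm_nonneg _)
          (hSup_nonneg _ _ _))
    refine ⟨holMem_zero_iff.2 ⟨hx.continuousOn.mul hy.continuousOn, _, key⟩, ?_⟩
    rw [holNorm_zero, holNorm_zero, holNorm_zero]
    nlinarith [hsup hx.continuousOn hy.continuousOn, holSemi_le hab key,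
      mul_nonneg (holSemi_nonneg a b 0 α x) (holSemi_nonneg a b 0 α y)]
  | succ n ih =>
    obtain ⟨C, hC0, hC⟩ := ih
    obtain ⟨D, hD0, hD⟩ := HolMem.of_succ hab hα1 n
    refine ⟨1 + 2 * C * D, by positivity, fun x y hx hy => ?_⟩
    have hx' := (holMem_succ_iff hab).1 hx
    have hy' := (holMem_succ_iff hab).1 hy
    have he : EqOn (fun t => derivWithin x (Icc a b) t * y t + x t * derivWithin y (Icc a b) t)
        (derivWithin (fun t => x t * y t) (Icc a b)) (Icc a b) := fun t ht =>
      (derivWithin_fun_mul (hx'.1 t ht) (hy'.1 t ht)).symm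
    have hxn := hD x hx
    have hyn := hD y hy
    have h1 := hC _ _ hx'.2 hyn.1
    have h2 := hC _ _ hxn.1 hy'.2
    have h3 := h1.1.add hab h2.1
    refine ⟨(holMem_succ_iff hab).2 ⟨hx'.1.mul hy'.1, h3.1.congr he⟩, ?_⟩
    rw [holNorm_succ, ← holNorm_congr he]
    have hxs := hSup_le_holNorm a b (n + 1) α x
    have hys := hSup_le_holNorm a b (n + 1) α y
    have hx1 : holNorm a b n α (derivWithin x (Icc a b)) ≤ holNorm a b (n + 1) α x := by
      rw [holNorm_succ]; linarith [hSup_nonneg a b x]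
    have hy1 : holNorm a b n α (derivWithin y (Icc a b)) ≤ holNorm a b (n + 1) α y := by
      rw [holNorm_succ]; linarith [hSup_nonneg a b y]
    have e1 : hSup a b (fun t => x t * y t) ≤ holNorm a b (n + 1) α x * holNorm a b (n + 1) α y :=
      (hsup hx.continuousOn hy.continuousOn).trans
        (mul_le_mul hxs hys (hSup_nonneg _ _ _) (holNorm_nonneg _ _ _ _ _))
    have e2 : holNorm a b n α (fun t => derivWithin x (Icc a b) t * y t) ≤
        C * holNorm a b (n + 1) α x * (D * holNorm a b (n + 1) α y) :=
      h1.2.trans (mul_le_mul (mul_le_mul_of_nonneg_left hx1 hC0) hyn.2 (holNorm_nonneg _ _ _ _ _)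
        (mul_nonneg hC0 (holNorm_nonneg _ _ _ _ _)))
    have e3 : holNorm a b n α (fun t => x t * derivWithin y (Icc a b) t) ≤
        C * (D * holNorm a b (n + 1) α x) * holNorm a b (n + 1) α y :=
      h2.2.trans (mul_le_mul (mul_le_mul_of_nonneg_left hxn.2 hC0) hy1 (holNorm_nonneg _ _ _ _ _)
        (mul_nonneg hC0 (mul_nonneg hD0 (holNorm_nonneg _ _ _ _ _))))
    have := h3.2
    nlinarith [e1, e2, e3, this]

lemma exists_antideriv {E : Type*} [NormedAddCommGroup E] [NormedSpace ℝ E] [CompleteSpace E]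
    {a b : ℝ} (hab : a < b) {g : ℝ → E} (hg : ContinuousOn g (Icc a b)) (q : E) :
    ∃ x : ℝ → E, x a = q ∧ ∀ t ∈ Icc a b, HasDerivWithinAt x (g t) (Icc a b) t := by
  let G : ℝ → E := IccExtend hab.le ((Icc a b).domRestrict g)
  have hG : Continuous G := (continuousOn_iff_continuous_domRestrict.1 hg).Icc_extend'
  refine ⟨fun t => q + ∫ s in a..t, G s, by simp, fun t ht => ?_⟩
  have h := (hG.integral_hasStrictDerivAt a t).hasDerivAt.const_add q
  have e : G t = g t := by
    simp only [G, IccExtend_of_mem hab.le _ ht]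
    rfl
  rw [e] at h
  exact h.hasDerivWithinAt

lemma hSup_le_of_deriv {a b : ℝ} (hab : a < b) {x : ℝ → ℂ} {D : ℝ}
    (hx : DifferentiableOn ℝ x (Icc a b))
    (hD : ∀ t ∈ Icc a b, ‖derivWithin x (Icc a b) t‖ ≤ D) :
    hSup a b x ≤ ‖x a‖ + D * (b - a) := by
  have ha : a ∈ Icc a b := ⟨le_refl _, hab.le⟩
  have hD0 : 0 ≤ D := (norm_nonneg _).trans (hD a ha)
  refine hSup_le hab fun t ht => ?_
  have h := (convex_Icc a b).norm_image_sub_le_of_norm_derivWithin_le hx hD ha ht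
  have h0 : ‖t - a‖ ≤ b - a := by
    rw [Real.norm_eq_abs, abs_of_nonneg (by linarith [ht.1])]
    linarith [ht.2]
  have h1 := mul_le_mul_of_nonneg_left h0 hD0
  have h2 := norm_le_norm_add_norm_sub' (x t) (x a)
  linarith

lemma hol_complete {a b : ℝ} (hab : a < b) {α : ℝ} (n : ℕ) (u : ℕ → ℝ → ℂ)
    (hu : ∀ k, HolMem a b n α (u k))
    (hc : ∀ ε > 0, ∃ N, ∀ k ≥ N, ∀ l ≥ N, holNorm a b n α (fun t => u k t - u l t) ≤ ε) :
    ∃ x, HolMem a b n α x ∧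
      Tendsto (fun k => holNorm a b n α (fun t => u k t - x t)) atTop (𝓝 0) := by
  have hcp : ∀ t ∈ Icc a b, ∃ y, Tendsto (fun k => u k t) atTop (𝓝 y) := by
    intro t ht
    apply cauchySeq_tendsto_of_complete
    rw [Metric.cauchySeq_iff]
    intro ε hε
    obtain ⟨N, hN⟩ := hc (ε / 2) (by positivity)
    refine ⟨N, fun k hk l hl => ?_⟩
    rw [dist_eq_norm]
    have := norm_le_holNorm ((hu k).sub hab (hu l)).1 ht
    linarith [hN k hk l hl]
  induction n generalizing u with
  | zero =>
    choose! x hx using hcp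
    have hb : ∀ ε > 0, ∃ N, ∀ k ≥ N, (∀ t ∈ Icc a b, ‖u k t - x t‖ ≤ ε) ∧
        ∀ t₁ ∈ Icc a b, ∀ t₂ ∈ Icc a b, t₁ < t₂ →
          ‖(u k t₂ - x t₂) - (u k t₁ - x t₁)‖ ≤ ε * (t₂ - t₁) ^ α := by
      intro ε hε
      obtain ⟨N, hN⟩ := hc ε hε
      refine ⟨N, fun k hk => ⟨fun t ht => ?_, fun t₁ h₁ t₂ h₂ h12 => ?_⟩⟩
      · refine le_of_tendsto ((tendsto_const_nhds.sub (hx t ht)).norm) ?_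
        filter_upwards [eventually_ge_atTop N] with l hl
        exact (norm_le_holNorm ((hu k).sub hab (hu l)).1 ht).trans (hN k hk l hl)
      · refine le_of_tendsto (((tendsto_const_nhds.sub (hx t₂ h₂)).sub
          (tendsto_const_nhds.sub (hx t₁ h₁))).norm) ?_
        filter_upwards [eventually_ge_atTop N] with l hl
        have h := le_holSemi ((hu k).sub hab (hu l)).1 h₁ h₂ h12
        refine h.trans ?_
        have : 0 < t₂ - t₁ := by linarith
        have h3 := hN k hk l hl
        rw [holNorm_zero] at h3
        have h4 := hSup_nonneg a b (fun t => u k t - u l t)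
        exact mul_le_mul_of_nonneg_right (by linarith) (by positivity)
    have hxc : ContinuousOn x (Icc a b) := by
      have : TendstoUniformlyOn u x atTop (Icc a b) := by
        rw [Metric.tendstoUniformlyOn_iff]
        intro ε hε
        obtain ⟨N, hN⟩ := hb (ε / 2) (by positivity)
        filter_upwards [eventually_ge_atTop N] with k hk t ht
        rw [dist_comm, dist_eq_norm]
        linarith [(hN k hk).1 t ht]
      exact this.continuousOn (Frequently.of_forall fun k => (hu k).continuousOn)
    refine ⟨x, ?_, ?_⟩
    · obtain ⟨N, hN⟩ := hb 1 one_pos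
      have h1 : HolMem a b 0 α (fun t => u N t - x t) :=
        holMem_zero_iff.2 ⟨(hu N).continuousOn.sub hxc, 1, (hN N le_rfl).2⟩
      have h2 := ((hu N).sub hab h1).1
      simpa using h2
    · rw [Metric.tendsto_atTop]
      intro ε hε
      obtain ⟨N, hN⟩ := hb (ε / 3) (by positivity)
      refine ⟨N, fun k hk => ?_⟩
      rw [Real.dist_0_eq_abs, abs_of_nonneg (holNorm_nonneg _ _ _ _ _), holNorm_zero]
      have h1 := hSup_le hab (hN k hk).1
      have h2 := holSemi_le hab (hN k hk).2
      linarith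
  | succ n ih =>
    have ha : a ∈ Icc a b := ⟨le_refl _, hab.le⟩
    have hu' := fun k => (holMem_succ_iff hab).1 (hu k)
    have he : ∀ k l, EqOn (derivWithin (fun t => u k t - u l t) (Icc a b))
        (fun t => derivWithin (u k) (Icc a b) t - derivWithin (u l) (Icc a b) t) (Icc a b) :=
      fun k l t ht => derivWithin_fun_sub ((hu' k).1 t ht) ((hu' l).1 t ht)
    have hc' : ∀ ε > 0, ∃ N, ∀ k ≥ N, ∀ l ≥ N, holNorm a b n α
        (fun t => derivWithin (u k) (Icc a b) t - derivWithin (u l) (Icc a b) t) ≤ ε := by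
      intro ε hε
      obtain ⟨N, hN⟩ := hc ε hε
      refine ⟨N, fun k hk l hl => ?_⟩
      have h := hN k hk l hl
      rw [holNorm_succ, holNorm_congr (he k l)] at h
      linarith [hSup_nonneg a b (fun t => u k t - u l t)]
    obtain ⟨g, hg, hgt⟩ := ih (fun k => derivWithin (u k) (Icc a b)) (fun k => (hu' k).2) hc' (by
      intro t ht
      apply cauchySeq_tendsto_of_complete
      rw [Metric.cauchySeq_iff]
      intro ε hε
      obtain ⟨N, hN⟩ := hc' (ε / 2) (by positivity)
      refine ⟨N, fun k hk l hl => ?_⟩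
      rw [dist_eq_norm]
      have := norm_le_holNorm ((hu' k).2.sub hab (hu' l).2).1 ht
      linarith [hN k hk l hl])
    obtain ⟨q, hq⟩ := hcp a ha
    obtain ⟨x, hxa, hx⟩ := exists_antideriv hab hg.continuousOn q
    have hxd : DifferentiableOn ℝ x (Icc a b) := fun t ht => (hx t ht).differentiableWithinAt
    have hxe : EqOn (derivWithin x (Icc a b)) g (Icc a b) := fun t ht =>
      (hx t ht).derivWithin (uniqueDiffOn_Icc hab t ht)
    have hde : ∀ k, EqOn (derivWithin (fun t => u k t - x t) (Icc a b))
        (fun t => derivWithin (u k) (Icc a b) t - g t) (Icc a b) := by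
      intro k t ht
      beta_reduce
      rw [← hxe ht]
      exact derivWithin_fun_sub ((hu' k).1 t ht) (hxd t ht)
    refine ⟨x, (holMem_succ_iff hab).2 ⟨hxd, hg.congr hxe.symm⟩, ?_⟩
    have hlim : Tendsto (fun k => ‖u k a - q‖ +
        holNorm a b n α (fun t => derivWithin (u k) (Icc a b) t - g t) * (b - a) +
        holNorm a b n α (fun t => derivWithin (u k) (Icc a b) t - g t)) atTop (𝓝 0) := by
      have h1 := (hq.sub_const q).norm
      have := (h1.add (hgt.mul_const (b - a))).add hgt
      simpa using this
    refine squeeze_zero (fun k => holNorm_nonneg _ _ _ _ _) (fun k => ?_) hlim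
    rw [holNorm_succ, holNorm_congr (hde k)]
    have := hSup_le_of_deriv hab ((hu' k).1.sub hxd) (D := holNorm a b n α
      (fun t => derivWithin (u k) (Icc a b) t - g t)) (fun t ht => by
        have := hde k ht
        change derivWithin (u k - x) (Icc a b) t = _ at this
        rw [this]
        exact norm_le_holNorm ((hu' k).2.sub hab hg).1 ht)
    rw [Pi.sub_apply, hxa] at this
    change hSup a b (fun t => u k t - x t) ≤ _ at this
    linarith

/-! ### Vector-valued functions -/

lemma vHolNorm_nonneg (a b : ℝ) (n : ℕ) (α : ℝ) {k : ℕ} (x : ℝ → (Fin k → ℂ)) :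
    0 ≤ vHolNorm a b n α x := Finset.sum_nonneg fun _ _ => holNorm_nonneg _ _ _ _ _

lemma holNorm_le_vHolNorm (a b : ℝ) (n : ℕ) (α : ℝ) {k : ℕ} (x : ℝ → (Fin k → ℂ)) (i : Fin k) :
    holNorm a b n α (fun t => x t i) ≤ vHolNorm a b n α x :=
  Finset.single_le_sum (f := fun i => holNorm a b n α (fun t => x t i))
    (fun _ _ => holNorm_nonneg _ _ _ _ _) (Finset.mem_univ i)

lemma vHolMem.add {a b : ℝ} (hab : a < b) {n : ℕ} {α : ℝ} {k : ℕ} {x y : ℝ → (Fin k → ℂ)}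
    (hx : vHolMem a b n α x) (hy : vHolMem a b n α y) : vHolMem a b n α (x + y) :=
  fun i => ((hx i).add hab (hy i)).1

lemma vHolNorm_add_le {a b : ℝ} (hab : a < b) {n : ℕ} {α : ℝ} {k : ℕ} {x y : ℝ → (Fin k → ℂ)}
    (hx : vHolMem a b n α x) (hy : vHolMem a b n α y) :
    vHolNorm a b n α (x + y) ≤ vHolNorm a b n α x + vHolNorm a b n α y := by
  unfold vHolNorm
  rw [← Finset.sum_add_distrib]
  exact Finset.sum_le_sum fun i _ => ((hx i).add hab (hy i)).2

lemma vHolMem.smul {a b : ℝ} (hab : a < b) {n : ℕ} {α : ℝ} {k : ℕ} {x : ℝ → (Fin k → ℂ)}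
    (hx : vHolMem a b n α x) (c : ℂ) : vHolMem a b n α (c • x) :=
  fun i => ((hx i).smul hab c).1

lemma vHolNorm_smul {a b : ℝ} (hab : a < b) {n : ℕ} {α : ℝ} {k : ℕ} {x : ℝ → (Fin k → ℂ)}
    (hx : vHolMem a b n α x) (c : ℂ) : vHolNorm a b n α (c • x) = ‖c‖ * vHolNorm a b n α x := by
  unfold vHolNorm
  rw [Finset.mul_sum]
  exact Finset.sum_congr rfl fun i _ => (hx i).norm_smul hab c

lemma vHolMem.sub {a b : ℝ} (hab : a < b) {n : ℕ} {α : ℝ} {k : ℕ} {x y : ℝ → (Fin k → ℂ)}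
    (hx : vHolMem a b n α x) (hy : vHolMem a b n α y) : vHolMem a b n α (x - y) :=
  fun i => ((hx i).sub hab (hy i)).1

lemma vHolNorm_sub_le {a b : ℝ} (hab : a < b) {n : ℕ} {α : ℝ} {k : ℕ} {x y : ℝ → (Fin k → ℂ)}
    (hx : vHolMem a b n α x) (hy : vHolMem a b n α y) :
    vHolNorm a b n α (x - y) ≤ vHolNorm a b n α x + vHolNorm a b n α y := by
  unfold vHolNorm
  rw [← Finset.sum_add_distrib]
  exact Finset.sum_le_sum fun i _ => ((hx i).sub hab (hy i)).2

lemma vHolNorm_congr {a b : ℝ} {n : ℕ} {α : ℝ} {k : ℕ} {x y : ℝ → (Fin k → ℂ)}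
    (h : EqOn x y (Icc a b)) : vHolNorm a b n α x = vHolNorm a b n α y :=
  Finset.sum_congr rfl fun i _ => holNorm_congr fun t ht => congrFun (h ht) i

lemma vHolMem.congr {a b : ℝ} {n : ℕ} {α : ℝ} {k : ℕ} {x y : ℝ → (Fin k → ℂ)}
    (hx : vHolMem a b n α x) (h : EqOn x y (Icc a b)) : vHolMem a b n α y :=
  fun i => (hx i).congr fun t ht => congrFun (h ht) i

lemma vHolMem.zero (a b : ℝ) (n : ℕ) (α : ℝ) (k : ℕ) :
    vHolMem a b n α (0 : ℝ → (Fin k → ℂ)) := fun i => HolMem.zero_fun _ _ _ _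

lemma vHolNorm_zero {a b : ℝ} (hab : a < b) (n : ℕ) (α : ℝ) (k : ℕ) :
    vHolNorm a b n α (0 : ℝ → (Fin k → ℂ)) = 0 := by
  have := vHolNorm_smul hab (vHolMem.zero a b n α k) 0
  simpa using this

lemma eq_zero_of_vHolNorm {a b : ℝ} {n : ℕ} {α : ℝ} {k : ℕ} {x : ℝ → (Fin k → ℂ)}
    (hx : vHolMem a b n α x) (h : vHolNorm a b n α x ≤ 0) : ∀ t ∈ Icc a b, x t = 0 := by
  intro t ht
  ext i
  have h1 := norm_le_holNorm (hx i) ht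
  have h2 := holNorm_le_vHolNorm a b n α x i
  exact norm_le_zero_iff.1 (by linarith)

/-- The Hölder space as a submodule of all functions. -/
def holSub (a b : ℝ) (hab : a < b) (n : ℕ) (α : ℝ) (k : ℕ) : Submodule ℂ (ℝ → (Fin k → ℂ)) where
  carrier := {x | vHolMem a b n α x}
  add_mem' hx hy := vHolMem.add hab hx hy
  zero_mem' := vHolMem.zero a b n α k
  smul_mem' c _ hx := vHolMem.smul hab hx c

/-- The same space, as a type without the subspace topology. -/
def HolSp (a b : ℝ) (hab : a < b) (n : ℕ) (α : ℝ) (k : ℕ) : Type := holSub a b hab n α k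

instance holSpACG (a b : ℝ) (hab : a < b) (n : ℕ) (α : ℝ) (k : ℕ) :
    AddCommGroup (HolSp a b hab n α k) :=
  inferInstanceAs (AddCommGroup (holSub a b hab n α k))

instance holSpModule (a b : ℝ) (hab : a < b) (n : ℕ) (α : ℝ) (k : ℕ) :
    Module ℂ (HolSp a b hab n α k) :=
  inferInstanceAs (Module ℂ (holSub a b hab n α k))

/-- The inclusion map. -/
def holSpIncl (a b : ℝ) (hab : a < b) (n : ℕ) (α : ℝ) (k : ℕ) :
    HolSp a b hab n α k →ₗ[ℂ] (ℝ → (Fin k → ℂ)) := (holSub a b hab n α k).subtype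

instance holSubNorm (a b : ℝ) (hab : a < b) (n : ℕ) (α : ℝ) (k : ℕ) : Norm (HolSp a b hab n α k) where
  norm x := vHolNorm a b n α x.1

lemma holSub_core (a b : ℝ) (hab : a < b) (n : ℕ) (α : ℝ) (k : ℕ) :
    SeminormedSpace.Core ℂ (HolSp a b hab n α k) where
  norm_nonneg x := vHolNorm_nonneg _ _ _ _ _
  norm_smul c x := vHolNorm_smul hab x.2 c
  norm_triangle x y := vHolNorm_add_le hab x.2 y.2

instance holSubSNG (a b : ℝ) (hab : a < b) (n : ℕ) (α : ℝ) (k : ℕ) :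
    SeminormedAddCommGroup (HolSp a b hab n α k) :=
  SeminormedAddCommGroup.ofCore (holSub_core a b hab n α k)

instance holSubNS (a b : ℝ) (hab : a < b) (n : ℕ) (α : ℝ) (k : ℕ) :
    NormedSpace ℂ (HolSp a b hab n α k) :=
  { norm_smul_le := fun c x => (vHolNorm_smul hab x.2 c).le }

lemma holSub_norm_def (a b : ℝ) (hab : a < b) (n : ℕ) (α : ℝ) (k : ℕ) (x : HolSp a b hab n α k) :
    ‖x‖ = vHolNorm a b n α x.1 := rfl

instance holSubComplete (a b : ℝ) (hab : a < b) (n : ℕ) (α : ℝ) (k : ℕ) :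
    CompleteSpace (HolSp a b hab n α k) := by
  apply Metric.complete_of_cauchySeq_tendsto
  intro u hu
  have hc : ∀ i : Fin k, ∃ x, HolMem a b n α x ∧
      Tendsto (fun p => holNorm a b n α (fun t => (u p).1 t i - x t)) atTop (𝓝 0) := by
    intro i
    refine hol_complete hab n (fun p t => (u p).1 t i) (fun p => (u p).2 i) fun ε hε => ?_
    rw [Metric.cauchySeq_iff] at hu
    obtain ⟨N, hN⟩ := hu ε hε
    refine ⟨N, fun p hp l hl => ?_⟩
    have h := hN p hp l hl
    rw [dist_eq_norm] at h
    have h' : vHolNorm a b n α ((u p).1 - (u l).1) < ε := h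
    exact (holNorm_le_vHolNorm a b n α ((u p).1 - (u l).1) i).trans h'.le
  choose x hx hxt using hc
  let X : HolSp a b hab n α k := ⟨fun t i => x i t, hx⟩
  refine ⟨X, ?_⟩
  rw [tendsto_iff_norm_sub_tendsto_zero]
  have := tendsto_finsetSum Finset.univ (fun i _ => hxt i)
  simp only [Finset.sum_const_zero] at this
  exact this

/-- Uniform boundedness of a pointwise convergent sequence of functionals. -/
lemma seq_unif_bound {a b : ℝ} (hab : a < b) {n : ℕ} {α : ℝ} {m p : ℕ}
    (T : ℕ → (ℝ → (Fin m → ℂ)) →ₗ[ℂ] (Fin p → ℂ))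
    (hT : ∀ k, ∃ K : ℝ, ∀ y, vHolMem a b n α y → ‖T k y‖ ≤ K * vHolNorm a b n α y)
    (hb : ∀ y, vHolMem a b n α y → ∃ C, ∀ k, ‖T k y‖ ≤ C) :
    ∃ K : ℝ, ∀ k, ∀ y, vHolMem a b n α y → ‖T k y‖ ≤ K * vHolNorm a b n α y := by
  choose K hK using hT
  let g : ℕ → HolSp a b hab n α m →L[ℂ] (Fin p → ℂ) := fun k =>
    ((T k).comp (holSpIncl a b hab n α m)).mkContinuous (K k) (fun y => hK k y.1 y.2)
  obtain ⟨C, hC⟩ := banach_steinhaus (g := g) (fun y => hb y.1 y.2)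
  refine ⟨C, fun k y hy => ?_⟩
  have := (g k).le_of_opNorm_le (hC k) ⟨y, hy⟩
  exact this

/-- Uniform boundedness along `ε → 0+`. -/
lemma unif_bound {a b : ℝ} (hab : a < b) {n : ℕ} {α : ℝ} {m p : ℕ}
    (B : ℝ → (ℝ → (Fin m → ℂ)) →ₗ[ℂ] (Fin p → ℂ)) {ε₀ : ℝ} (hε₀ : 0 < ε₀)
    (hB : ∀ ε ∈ Ico (0 : ℝ) ε₀, ∃ K : ℝ, ∀ y, vHolMem a b n α y → ‖B ε y‖ ≤ K * vHolNorm a b n α y)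
    (hII : ∀ y, vHolMem a b n α y → Tendsto (fun ε => B ε y) (𝓝[>] 0) (𝓝 (B 0 y))) :
    ∃ K : ℝ, ∀ᶠ ε in 𝓝[>] (0 : ℝ), ∀ y, vHolMem a b n α y → ‖B ε y‖ ≤ K * vHolNorm a b n α y := by
  by_contra hcon
  push Not at hcon
  have h1 : ∀ k : ℕ, ∃ᶠ ε in 𝓝[>] (0 : ℝ), ∃ y, vHolMem a b n α y ∧
      (k : ℝ) * vHolNorm a b n α y < ‖B ε y‖ := fun k => by
    simpa using hcon k
  have h2 : ∀ k : ℕ, ∃ ε ∈ Ioo (0 : ℝ) ε₀, ε < 1 / ((k : ℝ) + 1) ∧ ∃ y, vHolMem a b n α y ∧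
      (k : ℝ) * vHolNorm a b n α y < ‖B ε y‖ := by
    intro k
    have e1 : Ioo (0 : ℝ) ε₀ ∈ 𝓝[>] (0 : ℝ) := Ioo_mem_nhdsGT hε₀
    have e2 : Ioo (0 : ℝ) (1 / ((k : ℝ) + 1)) ∈ 𝓝[>] (0 : ℝ) := Ioo_mem_nhdsGT (by positivity)
    obtain ⟨ε, h, h', h''⟩ := ((h1 k).and_eventually (inter_mem e1 e2)).exists
    exact ⟨ε, h', h''.2, h⟩
  choose ε hε hε1 y hy hlt using h2
  have hlim : Tendsto ε atTop (𝓝[>] 0) := by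
    rw [tendsto_nhdsWithin_iff]
    refine ⟨squeeze_zero (fun k => (hε k).1.le) (fun k => (hε1 k).le)
      tendsto_one_div_add_atTop_nhds_zero_nat, Eventually.of_forall fun k => (hε k).1⟩
  obtain ⟨K, hK⟩ := seq_unif_bound hab (fun k => B (ε k))
    (fun k => hB (ε k) ⟨(hε k).1.le, (hε k).2⟩) (fun y hy => by
      have := ((hII y hy).comp hlim).norm.bddAbove_range
      obtain ⟨C, hC⟩ := this
      exact ⟨C, fun k => hC ⟨k, rfl⟩⟩)
  obtain ⟨k, hk⟩ := exists_nat_ge K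
  have e1 := hK k (y k) (hy k)
  have e2 := hlt k
  have e3 := mul_le_mul_of_nonneg_right hk (vHolNorm_nonneg a b n α (y k))
  linarith

lemma hasDerivWithinAt_Ici_of_Icc {E : Type*} [NormedAddCommGroup E] [NormedSpace ℝ E]
    {a b : ℝ} {f : ℝ → E} {f' : E} {x : ℝ} (hx : x ∈ Ico a b)
    (h : HasDerivWithinAt f f' (Icc a b) x) : HasDerivWithinAt f f' (Ici x) x :=
  h.mono_of_mem_nhdsWithin (Icc_mem_nhdsGE_of_mem hx)

lemma global_ode {E : Type*} [NormedAddCommGroup E] [NormedSpace ℝ E] [CompleteSpace E]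
    {a b : ℝ} (hab : a < b) (v : ℝ → E → E) {K : ℝ} (hK : 0 ≤ K)
    (hL : ∀ t ∈ Icc a b, ∀ x y, ‖v t x - v t y‖ ≤ K * ‖x - y‖)
    (hv : ∀ z : ℝ → E, ContinuousOn z (Icc a b) → ContinuousOn (fun t => v t (z t)) (Icc a b))
    (q : E) :
    ∃ z : ℝ → E, z a = q ∧ ∀ t ∈ Icc a b, HasDerivWithinAt z (v t (z t)) (Icc a b) t := by
  set l : ℝ := 2 * K + 1 with hl
  have hl0 : 0 < l := by positivity
  let ex : C(Icc a b, E) → ℝ → E := fun w s => Real.exp (l * (s - a)) • IccExtend hab.le w s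
  have hex : ∀ w, Continuous (ex w) := fun w => by
    have : Continuous (IccExtend hab.le w) := w.continuous.Icc_extend'
    exact (by fun_prop : Continuous fun s : ℝ => Real.exp (l * (s - a))).smul this
  have hΦ : ∀ w : C(Icc a b, E), ∃ z : ℝ → E, z a = q ∧
      ∀ t ∈ Icc a b, HasDerivWithinAt z (v t (ex w t)) (Icc a b) t := fun w =>
    exists_antideriv hab (hv _ (hex w).continuousOn) q
  choose Φ hΦa hΦd using hΦ
  have hΦc : ∀ w, ContinuousOn (Φ w) (Icc a b) := fun w t ht => (hΦd w t ht).continuousWithinAt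
  let F : C(Icc a b, E) → C(Icc a b, E) := fun w =>
    ⟨fun t => Real.exp (-(l * ((t : ℝ) - a))) • Φ w t,
      (by fun_prop : Continuous fun t : Icc a b => Real.exp (-(l * ((t : ℝ) - a)))).smul
        (continuousOn_iff_continuous_domRestrict.1 (hΦc w))⟩
  have hF : ContractingWith (1 / 2) F := by
    refine ⟨by norm_num, LipschitzWith.of_dist_le_mul fun w₁ w₂ => ?_⟩
    rw [ContinuousMap.dist_le (by positivity)]
    intro t
    set M := dist w₁ w₂ with hM
    have hM0 : 0 ≤ M := dist_nonneg
    have key := image_norm_le_of_norm_deriv_right_le_deriv_boundary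
      (f := fun s => Φ w₁ s - Φ w₂ s) (f' := fun s => v s (ex w₁ s) - v s (ex w₂ s)) (a := a) (b := b)
      (B := fun s => (K * M / l) * Real.exp (l * (s - a)))
      (B' := fun s => K * (Real.exp (l * (s - a)) * M))
      ((hΦc w₁).sub (hΦc w₂))
      (fun s hs => ((hasDerivWithinAt_Ici_of_Icc hs (hΦd w₁ s ⟨hs.1, hs.2.le⟩)).sub
        (hasDerivWithinAt_Ici_of_Icc hs (hΦd w₂ s ⟨hs.1, hs.2.le⟩))))
      (by simp only [hΦa, sub_self, norm_zero]; positivity)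
      (fun s => by
        have h1 : HasDerivAt (fun s : ℝ => l * (s - a)) l s := by
          simpa using ((hasDerivAt_id s).sub_const a).const_mul l
        have := h1.exp.const_mul (K * M / l)
        refine this.congr_deriv ?_
        field_simp)
      (fun s hs => by
        refine (hL s ⟨hs.1, hs.2.le⟩ _ _).trans (mul_le_mul_of_nonneg_left ?_ hK)
        simp only [ex]
        rw [← smul_sub, norm_smul, Real.norm_eq_abs, abs_of_pos (Real.exp_pos _)]
        refine mul_le_mul_of_nonneg_left ?_ (Real.exp_pos _).le
        rw [← dist_eq_norm]
        exact ContinuousMap.dist_apply_le_dist _)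
      t.2
    change dist (Real.exp (-(l * ((t : ℝ) - a))) • Φ w₁ t) (Real.exp (-(l * ((t : ℝ) - a))) • Φ w₂ t) ≤ _
    rw [dist_eq_norm, ← smul_sub, norm_smul, Real.norm_eq_abs, abs_of_pos (Real.exp_pos _)]
    refine (mul_le_mul_of_nonneg_left key (Real.exp_pos _).le).trans ?_
    have e : Real.exp (-(l * ((t : ℝ) - a))) * (K * M / l * Real.exp (l * ((t : ℝ) - a))) =
        K * M / l := by
      rw [Real.exp_neg]
      field_simp
    rw [e, div_le_iff₀ hl0]
    push_cast
    nlinarith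
  obtain ⟨w, hw⟩ : ∃ w, F w = w := by
    have : Nonempty C(Icc a b, E) := ⟨0⟩
    exact ⟨_, hF.fixedPoint_isFixedPt⟩
  refine ⟨Φ w, hΦa w, fun t ht => ?_⟩
  have h1 : Real.exp (-(l * (t - a))) • Φ w t = w ⟨t, ht⟩ := by
    conv_rhs => rw [← hw]
    rfl
  have h2 : ex w t = Φ w t := by
    simp only [ex, IccExtend_of_mem hab.le _ ht, ← h1, smul_smul, ← Real.exp_add]
    simp
  have := hΦd w t ht
  rwa [h2] at this

lemma gronwall_est {E : Type*} [NormedAddCommGroup E] [NormedSpace ℝ E]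
    {a b : ℝ} (hab : a < b) {K : ℝ} (hK : 0 < K) :
    ∃ C : ℝ, 0 ≤ C ∧ ∀ (z z' : ℝ → E) (e : ℝ), 0 ≤ e →
      (∀ t ∈ Icc a b, HasDerivWithinAt z (z' t) (Icc a b) t) →
      (∀ t ∈ Icc a b, ‖z' t‖ ≤ K * ‖z t‖ + e) → ∀ t ∈ Icc a b, ‖z t‖ ≤ C * (‖z a‖ + e) := by
  have h0 : 0 < b - a := by linarith
  have hE : 1 ≤ Real.exp (K * (b - a)) := Real.one_le_exp (by positivity)
  refine ⟨Real.exp (K * (b - a)) + (Real.exp (K * (b - a)) - 1) / K, ?_, ?_⟩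
  · have : 0 ≤ (Real.exp (K * (b - a)) - 1) / K := div_nonneg (by linarith) hK.le
    positivity
  intro z z' e he hz hb t ht
  have h := norm_le_gronwallBound_of_norm_deriv_right_le
    (fun t ht => (hz t ht).continuousWithinAt)
    (fun x hx => hasDerivWithinAt_Ici_of_Icc hx (hz x ⟨hx.1, hx.2.le⟩)) (le_refl ‖z a‖)
    (fun x hx => hb x ⟨hx.1, hx.2.le⟩) t ht
  refine h.trans ((gronwallBound_mono (norm_nonneg _) he hK.le
    (show t - a ≤ b - a by linarith [ht.2])).trans ?_)
  rw [gronwallBound_of_K_ne_0 hK.ne']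
  have h1 : 0 ≤ (Real.exp (K * (b - a)) - 1) / K := div_nonneg (by linarith) hK.le
  have h2 : e / K * (Real.exp (K * (b - a)) - 1) = (Real.exp (K * (b - a)) - 1) / K * e := by ring
  beta_reduce
  rw [h2]
  nlinarith [mul_nonneg h1 (norm_nonneg (z a)), norm_nonneg (z a), Real.exp_pos (K * (b - a)),
    mul_nonneg (Real.exp_pos (K * (b - a))).le he]

lemma holMem_add_iff {a b α : ℝ} (hab : a < b) {k : ℕ} (s : ℕ) (x : ℝ → ℂ) :
    HolMem a b (k + s) α x ↔
      (∀ j < s, DifferentiableOn ℝ (iteratedDerivWithin j x (Icc a b)) (Icc a b)) ∧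
      HolMem a b k α (iteratedDerivWithin s x (Icc a b)) := by
  induction s generalizing x with
  | zero => simp
  | succ s ih =>
    rw [← add_assoc, holMem_succ_iff hab, ih]
    simp only [← iteratedDerivWithin_succ']
    constructor
    · rintro ⟨h1, h2, h3⟩
      refine ⟨fun j hj => ?_, h3⟩
      cases j with
      | zero => simpa using h1
      | succ j => exact h2 j (by omega)
    · rintro ⟨h1, h2⟩
      exact ⟨by simpa using h1 0 (by omega), fun j hj => h1 (j + 1) (by omega), h2⟩

lemma holNorm_add_eq (a b α : ℝ) (k s : ℕ) (x : ℝ → ℂ) :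
    holNorm a b (k + s) α x =
      (∑ j ∈ Finset.range s, hSup a b (iteratedDerivWithin j x (Icc a b))) +
      holNorm a b k α (iteratedDerivWithin s x (Icc a b)) := by
  induction s generalizing x with
  | zero => simp
  | succ s ih =>
    rw [← add_assoc, holNorm_succ, ih, Finset.sum_range_succ']
    simp only [← iteratedDerivWithin_succ', iteratedDerivWithin_zero]
    ring

/-- intermediate derivatives -/
lemma HolMem.iter {a b α : ℝ} (hab : a < b) {k s j : ℕ} (hj : j ≤ s) {x : ℝ → ℂ}
    (hx : HolMem a b (k + s) α x) :
    HolMem a b (k + (s - j)) α (iteratedDerivWithin j x (Icc a b)) ∧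
      holNorm a b (k + (s - j)) α (iteratedDerivWithin j x (Icc a b)) ≤ holNorm a b (k + s) α x := by
  have e : k + s = (k + (s - j)) + j := by omega
  rw [e] at hx ⊢
  refine ⟨((holMem_add_iff hab j x).1 hx).2, ?_⟩
  rw [holNorm_add_eq a b α _ j x]
  have : 0 ≤ ∑ i ∈ Finset.range j, hSup a b (iteratedDerivWithin i x (Icc a b)) :=
    Finset.sum_nonneg fun _ _ => hSup_nonneg _ _ _
  linarith

lemma mHolNorm_nonneg (a b : ℝ) (n : ℕ) (α : ℝ) {k l : ℕ} (X : ℝ → Matrix (Fin k) (Fin l) ℂ) :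
    0 ≤ mHolNorm a b n α X :=
  Finset.sum_nonneg fun _ _ => Finset.sum_nonneg fun _ _ => holNorm_nonneg _ _ _ _ _

lemma row_le_mHolNorm (a b : ℝ) (n : ℕ) (α : ℝ) {k l : ℕ} (X : ℝ → Matrix (Fin k) (Fin l) ℂ)
    (i : Fin k) : ∑ j, holNorm a b n α (fun t => X t i j) ≤ mHolNorm a b n α X :=
  Finset.single_le_sum (f := fun i => ∑ j, holNorm a b n α (fun t => X t i j))
    (fun _ _ => Finset.sum_nonneg fun _ _ => holNorm_nonneg _ _ _ _ _) (Finset.mem_univ i)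

lemma mulVec_est {a b α : ℝ} (hab : a < b) (hα1 : α ≤ 1) (k r m : ℕ) :
    ∃ C, 0 ≤ C ∧ ∀ D : Fin r → ℝ → Matrix (Fin m) (Fin m) ℂ, (∀ j, mHolMem a b k α (D j)) →
      ∀ (Z : ℝ → Fin r → Fin m → ℂ) (R : ℝ),
        (∀ j i, HolMem a b k α (fun t => Z t j i) ∧ holNorm a b k α (fun t => Z t j i) ≤ R) →
        ∀ i, HolMem a b k α (fun t => ∑ j, ∑ l, D j t i l * Z t j l) ∧
          holNorm a b k α (fun t => ∑ j, ∑ l, D j t i l * Z t j l) ≤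
            C * (∑ j, mHolNorm a b k α (D j)) * R := by
  obtain ⟨C, hC, h⟩ := HolMem.mul hab hα1 k
  refine ⟨C, hC, fun D hD Z R hZ i => ?_⟩
  have h1 : ∀ j, ∀ l, _ := fun j l => h _ _ (hD j i l) (hZ j l).1
  have h2 : ∀ j, _ := fun j => HolMem.sum hab Finset.univ (fun l _ => (h1 j l).1)
  have h3 := HolMem.sum hab Finset.univ (fun j _ => (h2 j).1)
  refine ⟨h3.1, h3.2.trans ?_⟩
  rw [mul_assoc, Finset.sum_mul, Finset.mul_sum]
  refine Finset.sum_le_sum fun j _ => (h2 j).2.trans ?_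
  by_cases hm : Nonempty (Fin m)
  · have hR : 0 ≤ R := (holNorm_nonneg _ _ _ _ _).trans (hZ j i).2
    calc _ ≤ ∑ l, C * (holNorm a b k α (fun t => D j t i l) * R) := by
            refine Finset.sum_le_sum fun l _ => (h1 j l).2.trans ?_
            rw [mul_assoc]
            exact mul_le_mul_of_nonneg_left (mul_le_mul_of_nonneg_left (hZ j l).2
              (holNorm_nonneg _ _ _ _ _)) hC
      _ = C * ((∑ l, holNorm a b k α (fun t => D j t i l)) * R) := by
            rw [Finset.sum_mul, Finset.mul_sum]
      _ ≤ _ := mul_le_mul_of_nonneg_left (mul_le_mul_of_nonneg_right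
            (row_le_mHolNorm a b k α (D j) i) hR) hC
  · exact absurd ⟨i⟩ hm

/-- right hand side of the first-order system -/
def sysV {r m : ℕ} (A : Fin r → ℝ → Matrix (Fin m) (Fin m) ℂ) (f : ℝ → Fin m → ℂ) (t : ℝ)
    (z : Fin r → Fin m → ℂ) : Fin r → Fin m → ℂ := fun j i =>
  if h : (j : ℕ) + 1 < r then z ⟨j + 1, h⟩ i else f t i - ∑ j', ∑ l, A j' t i l * z j' l

lemma norm_comp_le {r m : ℕ} (z : Fin r → Fin m → ℂ) (j : Fin r) (i : Fin m) : ‖z j i‖ ≤ ‖z‖ :=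
  (norm_le_pi_norm (z j) i).trans (norm_le_pi_norm z j)

lemma norm_le_of_comp {r m : ℕ} {z : Fin r → Fin m → ℂ} {C : ℝ} (hC : 0 ≤ C)
    (h : ∀ j i, ‖z j i‖ ≤ C) : ‖z‖ ≤ C :=
  (pi_norm_le_iff_of_nonneg hC).2 fun j => (pi_norm_le_iff_of_nonneg hC).2 fun i => h j i

lemma sum_bound {a b α : ℝ} {n r m : ℕ} {A : Fin r → ℝ → Matrix (Fin m) (Fin m) ℂ}
    (hA : ∀ j, mHolMem a b n α (A j)) {t : ℝ} (ht : t ∈ Icc a b) (z : Fin r → Fin m → ℂ) (i : Fin m) :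
    ‖∑ j', ∑ l, A j' t i l * z j' l‖ ≤ (∑ j, mHolNorm a b n α (A j)) * ‖z‖ := by
  rw [Finset.sum_mul]
  refine norm_sum_le_of_le _ fun j _ => ?_
  refine le_trans ?_ (mul_le_mul_of_nonneg_right
    (row_le_mHolNorm a b n α (A j) i) (norm_nonneg z))
  rw [Finset.sum_mul]
  refine norm_sum_le_of_le _ fun l _ => ?_
  rw [norm_mul]
  exact mul_le_mul (norm_le_holNorm (hA j i l) ht) (norm_comp_le z j l) (norm_nonneg _)
    (holNorm_nonneg _ _ _ _ _)

lemma sysV_bound {a b α : ℝ} {n r m : ℕ} {A : Fin r → ℝ → Matrix (Fin m) (Fin m) ℂ}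
    (hA : ∀ j, mHolMem a b n α (A j)) {f : ℝ → Fin m → ℂ} {F : ℝ} (hF : 0 ≤ F)
    {t : ℝ} (ht : t ∈ Icc a b) (hf : ∀ i, ‖f t i‖ ≤ F)
    (z : Fin r → Fin m → ℂ) :
    ‖sysV A f t z‖ ≤ (1 + ∑ j, mHolNorm a b n α (A j)) * ‖z‖ + F := by
  have hS : 0 ≤ ∑ j, mHolNorm a b n α (A j) := Finset.sum_nonneg fun j _ => mHolNorm_nonneg _ _ _ _ _
  have h0 := norm_nonneg z
  have h1 := mul_nonneg hS h0
  refine norm_le_of_comp (by positivity) fun j i => ?_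
  unfold sysV
  split_ifs with h
  · have := norm_comp_le z ⟨j + 1, h⟩ i
    linarith
  · have := norm_sub_le (f t i) (∑ j', ∑ l, A j' t i l * z j' l)
    have := sum_bound hA ht z i
    have := hf i
    linarith

lemma sysV_sub {r m : ℕ} (A : Fin r → ℝ → Matrix (Fin m) (Fin m) ℂ) (f : ℝ → Fin m → ℂ) (t : ℝ)
    (z w : Fin r → Fin m → ℂ) : sysV A f t z - sysV A f t w = sysV A 0 t (z - w) := by
  ext j i
  simp only [sysV, Pi.sub_apply]
  split_ifs with h
  · rfl
  · simp [mul_sub, Finset.sum_sub_distrib]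

/-- regularity of solutions of the system, with estimates -/
lemma sys_reg {a b α : ℝ} (hab : a < b) (hα1 : α ≤ 1) {n r m : ℕ}
    {A : Fin r → ℝ → Matrix (Fin m) (Fin m) ℂ} (hA : ∀ j, mHolMem a b n α (A j)) (k : ℕ)
    (hk : k ≤ n + 1) :
    ∃ C, 0 ≤ C ∧ ∀ (f : ℝ → Fin m → ℂ) (Z : ℝ → Fin r → Fin m → ℂ), vHolMem a b n α f →
      (∀ t ∈ Icc a b, HasDerivWithinAt Z (sysV A f t (Z t)) (Icc a b) t) →
      ∀ j i, HolMem a b k α (fun t => Z t j i) ∧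
        holNorm a b k α (fun t => Z t j i) ≤ C * (‖Z a‖ + vHolNorm a b n α f) := by
  have hS : 0 ≤ ∑ j, mHolNorm a b n α (A j) := Finset.sum_nonneg fun j _ => mHolNorm_nonneg _ _ _ _ _
  set M := 1 + ∑ j, mHolNorm a b n α (A j) with hM
  have hM0 : 0 < M := by linarith
  obtain ⟨G, hG0, hG⟩ := gronwall_est (E := Fin r → Fin m → ℂ) hab hM0
  have hfn : ∀ f : ℝ → Fin m → ℂ, vHolMem a b n α f → ∀ t ∈ Icc a b, ∀ i, ‖f t i‖ ≤ vHolNorm a b n α f :=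
    fun f hf t ht i => (norm_le_holNorm (hf i) ht).trans (holNorm_le_vHolNorm a b n α f i)
  have hG' : ∀ (f : ℝ → Fin m → ℂ) (Z : ℝ → Fin r → Fin m → ℂ), vHolMem a b n α f →
      (∀ t ∈ Icc a b, HasDerivWithinAt Z (sysV A f t (Z t)) (Icc a b) t) → ∀ t ∈ Icc a b,
      ‖Z t‖ ≤ G * (‖Z a‖ + vHolNorm a b n α f) := fun f Z hf hZ =>
    hG Z (fun t => sysV A f t (Z t)) _ (vHolNorm_nonneg _ _ _ _ _) hZ (fun t ht =>
      sysV_bound hA (vHolNorm_nonneg _ _ _ _ _) ht (hfn f hf t ht) (Z t))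
  have hder : ∀ (f : ℝ → Fin m → ℂ) (Z : ℝ → Fin r → Fin m → ℂ),
      (∀ t ∈ Icc a b, HasDerivWithinAt Z (sysV A f t (Z t)) (Icc a b) t) → ∀ j i, ∀ t ∈ Icc a b,
      HasDerivWithinAt (fun t => Z t j i) (sysV A f t (Z t) j i) (Icc a b) t := fun f Z hZ j i t ht =>
    hasDerivWithinAt_pi.1 (hasDerivWithinAt_pi.1 (hZ t ht) j) i
  induction k with
  | zero =>
    refine ⟨G + (b - a) ^ (1 - α) * (M * G + 1), ?_, fun f Z hf hZ j i => ?_⟩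
    · have := Real.rpow_nonneg (sub_nonneg.2 hab.le) (1 - α)
      positivity
    have h1 := hder f Z hZ j i
    have hF := vHolNorm_nonneg a b n α f
    have hz := norm_nonneg (Z a)
    have h2 := holMem_zero_of_deriv hab hα1 (x := fun t => Z t j i)
      (D := (M * G + 1) * (‖Z a‖ + vHolNorm a b n α f))
      (fun t ht => (h1 t ht).differentiableWithinAt) (fun t ht => by
        rw [(h1 t ht).derivWithin (uniqueDiffOn_Icc hab t ht)]
        have e1 := norm_comp_le (sysV A f t (Z t)) j i
        have e2 := sysV_bound hA hF ht (hfn f hf t ht) (Z t)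
        have e3 := mul_le_mul_of_nonneg_left (hG' f Z hf hZ t ht) hM0.le
        rw [← hM] at e2
        nlinarith)
    refine ⟨h2.1, h2.2.trans ?_⟩
    have h3 : hSup a b (fun t => Z t j i) ≤ G * (‖Z a‖ + vHolNorm a b n α f) :=
      hSup_le hab fun t ht => (norm_comp_le _ _ _).trans (hG' f Z hf hZ t ht)
    linarith
  | succ k ih =>
    obtain ⟨C, hC, h⟩ := ih (by omega)
    obtain ⟨C₁, hC₁, h₁⟩ := HolMem.of_le hab hα1 (show k ≤ n by omega)
    obtain ⟨C₂, hC₂, h₂⟩ := mulVec_est hab hα1 k r m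
    have hS' : 0 ≤ ∑ j, mHolNorm a b k α (A j) :=
      Finset.sum_nonneg fun j _ => mHolNorm_nonneg _ _ _ _ _
    set S := ∑ j, mHolNorm a b k α (A j)
    refine ⟨G + (C + (C₁ + C₂ * S * C)), by positivity, fun f Z hf hZ j i => ?_⟩
    have h1 := hder f Z hZ j i
    have hF := vHolNorm_nonneg a b n α f
    have hz := norm_nonneg (Z a)
    have heq : EqOn (fun t => sysV A f t (Z t) j i) (derivWithin (fun t => Z t j i) (Icc a b)) (Icc a b) :=
      fun t ht => ((h1 t ht).derivWithin (uniqueDiffOn_Icc hab t ht)).symm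
    have h3 : hSup a b (fun t => Z t j i) ≤ G * (‖Z a‖ + vHolNorm a b n α f) :=
      hSup_le hab fun t ht => (norm_comp_le _ _ _).trans (hG' f Z hf hZ t ht)
    have h4 : HolMem a b k α (fun t => sysV A f t (Z t) j i) ∧
        holNorm a b k α (fun t => sysV A f t (Z t) j i) ≤
          (C + (C₁ + C₂ * S * C)) * (‖Z a‖ + vHolNorm a b n α f) := by
      unfold sysV
      split_ifs with hj
      · refine ⟨(h f Z hf hZ ⟨j + 1, hj⟩ i).1, (h f Z hf hZ ⟨j + 1, hj⟩ i).2.trans ?_⟩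
        have : 0 ≤ C₁ + C₂ * S * C := by positivity
        apply mul_le_mul_of_nonneg_right <;> linarith
      · have e1 := h₁ _ (hf i)
        have e2 := h₂ A (fun j i l => (h₁ _ (hA j i l)).1) Z _ (fun j i => h f Z hf hZ j i) i
        have e3 := e1.1.sub hab e2.1
        refine ⟨e3.1, e3.2.trans ((add_le_add e1.2 e2.2).trans ?_)⟩
        have e4 := mul_le_mul_of_nonneg_left (holNorm_le_vHolNorm a b n α f i) hC₁
        have e5 := mul_nonneg hC₁ hz
        have e6 := mul_nonneg hC (add_nonneg hz hF)
        change _ + C₂ * S * _ ≤ _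
        linarith
    refine ⟨(holMem_succ_iff hab).2 ⟨fun t ht => (h1 t ht).differentiableWithinAt, h4.1.congr heq⟩, ?_⟩
    rw [holNorm_succ, ← holNorm_congr heq]
    linarith [h4.2]

/-- the jet of a function -/
def jet (a b : ℝ) (r : ℕ) {m : ℕ} (y : ℝ → Fin m → ℂ) (t : ℝ) : Fin r → Fin m → ℂ :=
  fun j => vDeriv a b (j : ℕ) y t

lemma vDeriv_lin {a b α : ℝ} (hab : a < b) {k p m : ℕ} (hp : p ≤ k) {x y : ℝ → Fin m → ℂ}
    (hx : vHolMem a b k α x) (hy : vHolMem a b k α y) (c : ℂ) {t : ℝ} (ht : t ∈ Icc a b) :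
    vDeriv a b p (x + c • y) t = vDeriv a b p x t + c • vDeriv a b p y t := by
  ext i
  have hx' : ContDiffWithinAt ℝ p (fun s => x s i) (Icc a b) t :=
    ((hx i).1.of_le (by exact_mod_cast hp)) t ht
  have hy' : ContDiffWithinAt ℝ p (fun s => y s i) (Icc a b) t :=
    ((hy i).1.of_le (by exact_mod_cast hp)) t ht
  simp only [vDeriv, Pi.add_apply, Pi.smul_apply, smul_eq_mul]
  rw [iteratedDerivWithin_fun_add ht (uniqueDiffOn_Icc hab) hx' (contDiffWithinAt_const.mul hy'),
    iteratedDerivWithin_const_mul ht (uniqueDiffOn_Icc hab) c hy']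

lemma Lop_lin {a b α : ℝ} (hab : a < b) {n r m : ℕ} (A : Fin r → ℝ → Matrix (Fin m) (Fin m) ℂ)
    {x y : ℝ → Fin m → ℂ}
    (hx : vHolMem a b (n + r) α x) (hy : vHolMem a b (n + r) α y) (c : ℂ) {t : ℝ} (ht : t ∈ Icc a b) :
    Lop a b r A (x + c • y) t = Lop a b r A x t + c • Lop a b r A y t := by
  unfold Lop
  rw [vDeriv_lin hab (by omega) hx hy c ht, smul_add, Finset.smul_sum]
  have : ∀ j : Fin r, (A j t).mulVec (vDeriv a b (j : ℕ) (x + c • y) t) =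
      (A j t).mulVec (vDeriv a b (j : ℕ) x t) + c • (A j t).mulVec (vDeriv a b (j : ℕ) y t) := by
    intro j
    rw [vDeriv_lin hab (by omega) hx hy c ht, Matrix.mulVec_add, Matrix.mulVec_smul]
  simp only [this, Finset.sum_add_distrib]
  abel

lemma jet_lin {a b α : ℝ} (hab : a < b) {n r m : ℕ} {x y : ℝ → Fin m → ℂ}
    (hx : vHolMem a b (n + r) α x) (hy : vHolMem a b (n + r) α y) (c : ℂ) {t : ℝ} (ht : t ∈ Icc a b) :
    jet a b r (x + c • y) t = jet a b r x t + c • jet a b r y t := by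
  ext1 j
  exact vDeriv_lin hab (by omega) hx hy c ht

lemma low_est {a b α : ℝ} (hab : a < b) (hα1 : α ≤ 1) (n r m : ℕ) :
    ∃ C, 0 ≤ C ∧ ∀ D : Fin r → ℝ → Matrix (Fin m) (Fin m) ℂ, (∀ j, mHolMem a b n α (D j)) →
      ∀ y : ℝ → Fin m → ℂ, vHolMem a b (n + r) α y →
        vHolMem a b n α (fun t => ∑ j : Fin r, (D j t).mulVec (vDeriv a b (j : ℕ) y t)) ∧
        vHolNorm a b n α (fun t => ∑ j : Fin r, (D j t).mulVec (vDeriv a b (j : ℕ) y t)) ≤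
          C * (∑ j, mHolNorm a b n α (D j)) * vHolNorm a b (n + r) α y := by
  obtain ⟨C, hC, h⟩ := mulVec_est hab hα1 n r m
  have hE : ∀ p : ℕ, ∃ E, 0 ≤ E ∧ ∀ x, HolMem a b (n + p) α x → HolMem a b n α x ∧
      holNorm a b n α x ≤ E * holNorm a b (n + p) α x := fun p =>
    HolMem.of_le hab hα1 (show n ≤ n + p by omega)
  choose E hE0 hE using hE
  have hE1 : 0 ≤ ∑ p ∈ Finset.range (r + 1), E p := Finset.sum_nonneg fun p _ => hE0 p
  refine ⟨m * (C * (∑ p ∈ Finset.range (r + 1), E p)), by positivity, fun D hD y hy => ?_⟩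
  set T := ∑ p ∈ Finset.range (r + 1), E p
  have h1 := h D hD (fun t => jet a b r y t) (T * vHolNorm a b (n + r) α y) (by
    intro j i
    have e1 := (hy i).iter hab (j := j) (by omega)
    have e2 := hE (r - j) _ e1.1
    refine ⟨e2.1, e2.2.trans ?_⟩
    refine mul_le_mul (Finset.single_le_sum (fun p _ => hE0 p)
      (Finset.mem_range.2 (by omega))) (e1.2.trans (holNorm_le_vHolNorm a b (n + r) α y i))
      (holNorm_nonneg _ _ _ _ _) hE1)
  have e : ∀ i, (fun t => (∑ j : Fin r, (D j t).mulVec (vDeriv a b (j : ℕ) y t)) i) =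
      fun t => ∑ j, ∑ l, D j t i l * jet a b r y t j l := by
    intro i
    ext t
    simp only [Finset.sum_apply, Matrix.mulVec, dotProduct, jet]
  refine ⟨fun i => ?_, ?_⟩
  · rw [e]
    exact (h1 i).1
  · unfold vHolNorm at h1 ⊢
    simp only [e]
    refine (Finset.sum_le_card_nsmul _ _ _ (fun i _ => (h1 i).2)).trans_eq ?_
    simp
    ring

lemma Lop_mem {a b α : ℝ} (hab : a < b) (hα1 : α ≤ 1) {n r m : ℕ}
    {A : Fin r → ℝ → Matrix (Fin m) (Fin m) ℂ} (hA : ∀ j, mHolMem a b n α (A j))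
    {y : ℝ → Fin m → ℂ} (hy : vHolMem a b (n + r) α y) : vHolMem a b n α (Lop a b r A y) := by
  obtain ⟨C, _, h⟩ := low_est hab hα1 n r m
  have h1 : vHolMem a b n α (vDeriv a b r y) := fun i => by
    have := ((hy i).iter hab (le_refl r)).1
    rw [Nat.sub_self, add_zero] at this
    exact this
  exact h1.add hab (h A hA y hy).1

lemma jet_sys {a b α : ℝ} (hab : a < b) {n r m : ℕ}
    (A : Fin r → ℝ → Matrix (Fin m) (Fin m) ℂ)
    {y : ℝ → Fin m → ℂ} (hy : vHolMem a b (n + r) α y) {t : ℝ} (ht : t ∈ Icc a b) :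
    HasDerivWithinAt (jet a b r y) (sysV A (Lop a b r A y) t (jet a b r y t)) (Icc a b) t := by
  refine hasDerivWithinAt_pi.2 fun j => hasDerivWithinAt_pi.2 fun i => ?_
  have h1 := ((holMem_add_iff hab r _).1 (hy i)).1 j j.2 t ht
  have h2 := h1.hasDerivWithinAt
  rw [← iteratedDerivWithin_succ] at h2
  suffices hs : sysV A (Lop a b r A y) t (jet a b r y t) j i =
      iteratedDerivWithin (j + 1) (fun s => y s i) (Icc a b) t by
    rw [hs]
    exact h2
  unfold sysV
  split_ifs with h
  · rfl
  · have e : r = j + 1 := by omega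
    simp only [Lop, jet, Pi.add_apply, Finset.sum_apply, Matrix.mulVec, dotProduct, add_sub_cancel_right]
    simp only [vDeriv]
    rw [show iteratedDerivWithin r (fun s => y s i) (Icc a b) t =
      iteratedDerivWithin (j + 1) (fun s => y s i) (Icc a b) t by rw [← e]]

lemma apriori {a b α : ℝ} (hab : a < b) (hα1 : α ≤ 1) {n r m : ℕ} (hr : 0 < r)
    {A : Fin r → ℝ → Matrix (Fin m) (Fin m) ℂ} (hA : ∀ j, mHolMem a b n α (A j)) :
    ∃ C, 0 ≤ C ∧ ∀ y : ℝ → Fin m → ℂ, vHolMem a b (n + r) α y →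
      vHolNorm a b (n + r) α y ≤ C * (‖jet a b r y a‖ + vHolNorm a b n α (Lop a b r A y)) := by
  obtain ⟨C, hC, h⟩ := sys_reg hab hα1 hA (n + 1) le_rfl
  refine ⟨m * (r * C), by positivity, fun y hy => ?_⟩
  have h1 := h (Lop a b r A y) (jet a b r y) (Lop_mem hab hα1 hA hy) (fun t ht => jet_sys hab A hy ht)
  set R := ‖jet a b r y a‖ + vHolNorm a b n α (Lop a b r A y)
  have h2 : ∀ i, holNorm a b (n + r) α (fun t => y t i) ≤ r * C * R := by
    intro i
    obtain ⟨s, rfl⟩ : ∃ s, r = s + 1 := ⟨r - 1, by omega⟩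
    rw [show n + (s + 1) = n + 1 + s by ring, holNorm_add_eq]
    have e1 : ∑ j ∈ Finset.range s, hSup a b (iteratedDerivWithin j (fun t => y t i) (Icc a b)) ≤
        ∑ j ∈ Finset.range s, C * R := Finset.sum_le_sum fun j hj => by
      have hj' := Finset.mem_range.1 hj
      exact (hSup_le_holNorm a b (n + 1) α _).trans (h1 ⟨j, by omega⟩ i).2
    have e2 := (h1 ⟨s, by omega⟩ i).2
    have e3 : holNorm a b (n + 1) α (iteratedDerivWithin s (fun t => y t i) (Icc a b)) ≤ C * R := e2
    simp only [Finset.sum_const, Finset.card_range, nsmul_eq_mul] at e1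
    push_cast
    linarith
  refine (Finset.sum_le_card_nsmul _ _ _ (fun i _ => h2 i)).trans_eq ?_
  simp
  ring

lemma exists_ivp {a b α : ℝ} (hab : a < b) (hα1 : α ≤ 1) {n r m : ℕ} (hr : 0 < r)
    {A : Fin r → ℝ → Matrix (Fin m) (Fin m) ℂ} (hA : ∀ j, mHolMem a b n α (A j))
    {f : ℝ → Fin m → ℂ} (hf : vHolMem a b n α f) (q : Fin r → Fin m → ℂ) :
    ∃ y : ℝ → Fin m → ℂ, vHolMem a b (n + r) α y ∧ (∀ t ∈ Icc a b, Lop a b r A y t = f t) ∧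
      jet a b r y a = q := by
  have ha : a ∈ Icc a b := ⟨le_rfl, hab.le⟩
  have hS : 0 ≤ ∑ j, mHolNorm a b n α (A j) := Finset.sum_nonneg fun j _ => mHolNorm_nonneg _ _ _ _ _
  obtain ⟨Z, hZa, hZ⟩ := global_ode hab (sysV A f) (K := 1 + ∑ j, mHolNorm a b n α (A j)) (by linarith)
    (fun t ht x y => by
      rw [sysV_sub]
      simpa using sysV_bound hA (le_refl 0) ht (f := 0) (by simp) (x - y))
    (fun z hz => by
      refine continuousOn_pi.2 fun j => continuousOn_pi.2 fun i => ?_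
      have hzc : ∀ j i, ContinuousOn (fun t => z t j i) (Icc a b) := fun j i =>
        continuousOn_pi.1 (continuousOn_pi.1 hz j) i
      unfold sysV
      split_ifs with h
      · exact hzc _ _
      · exact (hf i).continuousOn.sub (continuousOn_finsetSum _ fun j' _ =>
          continuousOn_finsetSum _ fun l _ => (hA j' i l).continuousOn.mul (hzc j' l))) q
  obtain ⟨C, hC, h⟩ := sys_reg hab hα1 hA (n + 1) le_rfl
  have hreg := fun j i => (h f Z hf hZ j i).1
  have hder : ∀ j i, ∀ t ∈ Icc a b,
      HasDerivWithinAt (fun t => Z t j i) (sysV A f t (Z t) j i) (Icc a b) t := fun j i t ht =>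
    hasDerivWithinAt_pi.1 (hasDerivWithinAt_pi.1 (hZ t ht) j) i
  let y : ℝ → Fin m → ℂ := fun t => Z t ⟨0, hr⟩
  have hit : ∀ (j : ℕ) (hj : j < r) (i : Fin m),
      EqOn (iteratedDerivWithin j (fun t => y t i) (Icc a b)) (fun t => Z t ⟨j, hj⟩ i) (Icc a b) := by
    intro j
    induction j with
    | zero => intro hj i t ht; simp [y]
    | succ j ih =>
      intro hj i t ht
      rw [iteratedDerivWithin_succ, derivWithin_congr (ih (by omega) i) (ih (by omega) i ht),
        (hder ⟨j, by omega⟩ i t ht).derivWithin (uniqueDiffOn_Icc hab t ht)]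
      simp [sysV, hj]
  have hlast : ∀ i, ∀ t ∈ Icc a b, iteratedDerivWithin r (fun t => y t i) (Icc a b) t =
      f t i - ∑ j', ∑ l, A j' t i l * Z t j' l := by
    intro i t ht
    obtain ⟨s, rfl⟩ : ∃ s, r = s + 1 := ⟨r - 1, by omega⟩
    rw [iteratedDerivWithin_succ, derivWithin_congr (hit s (by omega) i) (hit s (by omega) i ht),
        (hder ⟨s, by omega⟩ i t ht).derivWithin (uniqueDiffOn_Icc hab t ht)]
    simp [sysV]
  refine ⟨y, fun i => ?_, fun t ht => ?_, ?_⟩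
  · obtain ⟨s, rfl⟩ : ∃ s, r = s + 1 := ⟨r - 1, by omega⟩
    rw [show n + (s + 1) = n + 1 + s by ring, holMem_add_iff hab]
    refine ⟨fun j hj => ?_, (hreg ⟨s, by omega⟩ i).congr (hit s (by omega) i).symm⟩
    exact DifferentiableOn.congr (fun t ht => (hder ⟨j, by omega⟩ i t ht).differentiableWithinAt)
      (hit j (by omega) i)
  · ext i
    simp only [Lop, Pi.add_apply, Finset.sum_apply, Matrix.mulVec, dotProduct, vDeriv]
    rw [hlast i t ht]
    have : ∀ (j : Fin r) (l : Fin m), iteratedDerivWithin (j : ℕ) (fun t => y t l) (Icc a b) t = Z t j l :=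
      fun j l => hit j j.2 l ht
    simp only [this]
    ring
  · ext j i
    rw [← hZa]
    exact hit j j.2 i ha

lemma jet_zero_of {a b : ℝ} (hab : a < b) {r m : ℕ} {y : ℝ → Fin m → ℂ} (hy : ∀ t ∈ Icc a b, y t = 0) :
    jet a b r y a = 0 := by
  have ha : a ∈ Icc a b := ⟨le_rfl, hab.le⟩
  ext j i
  simp only [jet, vDeriv]
  rw [iteratedDerivWithin_congr (f := fun s => y s i) (g := fun _ => (0 : ℂ))
    (fun t ht => by simp [hy t ht]) ha]
  simp

lemma Lop_zero {a b : ℝ} {r m : ℕ} (A : Fin r → ℝ → Matrix (Fin m) (Fin m) ℂ) {t : ℝ} :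
    Lop a b r A 0 t = 0 := by
  have : ∀ p, vDeriv a b p (0 : ℝ → Fin m → ℂ) t = 0 := by
    intro p
    ext i
    simp only [vDeriv, Pi.zero_apply]
    simp
  simp [Lop, this]

lemma exists_fund {a b α : ℝ} (hab : a < b) (hα1 : α ≤ 1) {n r m : ℕ} (hr : 0 < r)
    {A : Fin r → ℝ → Matrix (Fin m) (Fin m) ℂ} (hA : ∀ j, mHolMem a b n α (A j)) :
    ∃ Φ : (Fin r → Fin m → ℂ) →ₗ[ℂ] (ℝ → Fin m → ℂ), ∀ q, vHolMem a b (n + r) α (Φ q) ∧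
      (∀ t ∈ Icc a b, Lop a b r A (Φ q) t = 0) ∧ jet a b r (Φ q) a = q := by
  have ha : a ∈ Icc a b := ⟨le_rfl, hab.le⟩
  have h := fun q => exists_ivp hab hα1 hr hA (vHolMem.zero a b n α m) q
  choose u hu1 hu2 hu3 using h
  let bs := Module.finBasis ℂ (Fin r → Fin m → ℂ)
  refine ⟨bs.constr ℂ (fun i => u (bs i)), fun q => ?_⟩
  have hq : q ∈ Submodule.span ℂ (range bs) := bs.mem_span q
  induction hq using Submodule.span_induction with
  | mem x hx =>
    obtain ⟨i, rfl⟩ := hx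
    rw [Module.Basis.constr_basis]
    exact ⟨hu1 _, fun t ht => by simpa using hu2 _ t ht, hu3 _⟩
  | zero =>
    rw [map_zero]
    exact ⟨vHolMem.zero _ _ _ _ _, fun t ht => Lop_zero A, jet_zero_of hab (fun t _ => rfl)⟩
  | add x y _ _ hx hy =>
    rw [map_add]
    refine ⟨hx.1.add hab hy.1, fun t ht => ?_, ?_⟩
    · have := Lop_lin hab A hx.1 hy.1 1 ht
      rw [one_smul, one_smul, hx.2.1 t ht, hy.2.1 t ht] at this
      simpa using this
    · have := jet_lin hab hx.1 hy.1 1 ha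
      rw [one_smul, one_smul, hx.2.2, hy.2.2] at this
      exact this
  | smul c x _ hx =>
    rw [map_smul]
    refine ⟨hx.1.smul hab c, fun t ht => ?_, ?_⟩
    · have := Lop_lin hab A (vHolMem.zero a b (n + r) α m) hx.1 c ht
      rw [zero_add, hx.2.1 t ht, Lop_zero] at this
      simpa using this
    · have := jet_lin hab (vHolMem.zero a b (n + r) α m) hx.1 c ha
      rw [zero_add, hx.2.2, jet_zero_of hab (y := 0) (fun t _ => rfl), zero_add] at this
      exact this

lemma Lop_diff {a b : ℝ} {r m : ℕ} (A A' : Fin r → ℝ → Matrix (Fin m) (Fin m) ℂ)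
    (y : ℝ → Fin m → ℂ) : Lop a b r A y = Lop a b r A' y -
      fun t => ∑ j : Fin r, (A' j t - A j t).mulVec (vDeriv a b (j : ℕ) y t) := by
  ext1 t
  simp only [Lop, Pi.sub_apply, Matrix.sub_mulVec, Finset.sum_sub_distrib]
  abel

lemma unif_est {a b α : ℝ} (hab : a < b) (hα1 : α ≤ 1) {n r m : ℕ} (hr : 0 < r)
    {A : Fin r → ℝ → Matrix (Fin m) (Fin m) ℂ} (hA : ∀ j, mHolMem a b n α (A j))
    (B : (ℝ → (Fin m → ℂ)) →ₗ[ℂ] (Fin (r * m) → ℂ)) (h0 : Cond0 a b n α r m A B)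
    (Φ : (Fin r → Fin m → ℂ) →ₗ[ℂ] (ℝ → Fin m → ℂ))
    (hΦ : ∀ q, vHolMem a b (n + r) α (Φ q) ∧
      (∀ t ∈ Icc a b, Lop a b r A (Φ q) t = 0) ∧ jet a b r (Φ q) a = q) {K : ℝ} (hK : 0 ≤ K) :
    ∃ δ, 0 < δ ∧ ∃ C, 0 ≤ C ∧ ∀ (A' : Fin r → ℝ → Matrix (Fin m) (Fin m) ℂ)
      (B' : (ℝ → (Fin m → ℂ)) →ₗ[ℂ] (Fin (r * m) → ℂ)), (∀ j, mHolMem a b n α (A' j)) →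
      (∀ y, vHolMem a b (n + r) α y → ‖B' y‖ ≤ K * vHolNorm a b (n + r) α y) →
      (∑ j, mHolNorm a b n α (fun t => A' j t - A j t) ≤ δ) →
      (∀ q, ‖B' (Φ q) - B (Φ q)‖ ≤ δ * ‖q‖) →
      ∀ y, vHolMem a b (n + r) α y →
        vHolNorm a b (n + r) α y ≤ C * (vHolNorm a b n α (Lop a b r A' y) + ‖B' y‖) := by
  have ha : a ∈ Icc a b := ⟨le_rfl, hab.le⟩
  obtain ⟨C₁, hC₁, h₁⟩ := apriori hab hα1 hr hA
  obtain ⟨C₂, hC₂, h₂⟩ := low_est hab hα1 n r m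
  have hinj : LinearMap.ker (B ∘ₗ Φ) = ⊥ := by
    rw [LinearMap.ker_eq_bot']
    intro q hq
    rw [← (hΦ q).2.2]
    exact jet_zero_of hab (h0 _ (hΦ q).1 (hΦ q).2.1 hq)
  obtain ⟨κ, _, hκ⟩ := LinearMap.exists_antilipschitzWith _ hinj
  obtain ⟨k, hκ0, hκ'⟩ : ∃ k : ℝ, 0 ≤ k ∧ ∀ q, ‖q‖ ≤ k * ‖B (Φ q)‖ := by
    refine ⟨κ, κ.2, fun q => ?_⟩
    have := hκ.le_mul_dist q 0
    simpa [dist_eq_norm] using this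
  set M := 1 + 2 * k * K * C₁ with hM
  have hM0 : 0 ≤ M := by positivity
  set P := M * C₁ * C₂ with hP
  have hP0 : 0 ≤ P := by positivity
  refine ⟨min (1 / (2 * (k + 1))) (1 / (2 * (P + 1))), by positivity, 2 * M * C₁ + 4 * k * C₁,
    by positivity, fun A' B' hA' hB' hAd hBd y hy => ?_⟩
  set δ := min (1 / (2 * (k + 1))) (1 / (2 * (P + 1)))
  have hδ0 : 0 < δ := by positivity
  have hδ1 : k * δ ≤ 1 / 2 := by
    have : δ ≤ 1 / (2 * (k + 1)) := min_le_left _ _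
    calc k * δ ≤ (k + 1) * (1 / (2 * (k + 1))) := by
          apply mul_le_mul (by linarith) this hδ0.le (by linarith)
      _ = 1 / 2 := by field_simp
  have hδ2 : P * δ ≤ 1 / 2 := by
    have : δ ≤ 1 / (2 * (P + 1)) := min_le_right _ _
    calc P * δ ≤ (P + 1) * (1 / (2 * (P + 1))) := by
          apply mul_le_mul (by linarith) this hδ0.le (by linarith)
      _ = 1 / 2 := by field_simp
  set q := jet a b r y a with hq
  obtain ⟨hΦ1, hΦ2, hΦ3⟩ := hΦ q
  have hw : vHolMem a b (n + r) α (y + (-1 : ℂ) • Φ q) := hy.add hab (hΦ1.smul hab _)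
  set w := y + (-1 : ℂ) • Φ q with hwd
  have hjw : jet a b r w a = 0 := by
    rw [hwd, jet_lin hab hy hΦ1 _ ha, hΦ3, ← hq]
    simp
  have hLw : EqOn (Lop a b r A w) (Lop a b r A y) (Icc a b) := fun t ht => by
    rw [hwd, Lop_lin hab A hy hΦ1 _ ht, hΦ2 t ht]
    simp
  have hNw := h₁ w hw
  rw [hjw, norm_zero, zero_add, vHolNorm_congr hLw] at hNw
  have hD : ∀ j, mHolMem a b n α (fun t => A' j t - A j t) := fun j i l =>
    ((hA' j i l).sub hab (hA j i l)).1
  have hlow := h₂ _ hD y hy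
  have hL0 : vHolNorm a b n α (Lop a b r A y) ≤ vHolNorm a b n α (Lop a b r A' y) +
      C₂ * δ * vHolNorm a b (n + r) α y := by
    rw [Lop_diff A A' y]
    refine (vHolNorm_sub_le hab (Lop_mem hab hα1 hA' hy) hlow.1).trans ?_
    have := mul_le_mul_of_nonneg_right (mul_le_mul_of_nonneg_left hAd hC₂)
      (vHolNorm_nonneg a b (n + r) α y)
    linarith [hlow.2]
  have hNΦ := h₁ (Φ q) hΦ1
  have hz : vHolNorm a b n α (Lop a b r A (Φ q)) = 0 := by
    rw [vHolNorm_congr (y := 0) (fun t ht => hΦ2 t ht), vHolNorm_zero hab]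
  rw [hΦ3, hz, add_zero] at hNΦ
  have hyw : y = w + Φ q := by rw [hwd]; simp
  have hN : vHolNorm a b (n + r) α y ≤ vHolNorm a b (n + r) α w + C₁ * ‖q‖ := by
    have := vHolNorm_add_le hab hw hΦ1
    rw [← hyw] at this
    linarith
  have hBq : ‖B (Φ q)‖ ≤ ‖B' y‖ + K * vHolNorm a b (n + r) α w + δ * ‖q‖ := by
    have e1 : B (Φ q) = B' y - B' w - (B' (Φ q) - B (Φ q)) := by
      have : B' y = B' w + B' (Φ q) := by rw [← map_add, ← hyw]
      rw [this]
      abel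
    rw [e1]
    have := norm_sub_le (B' y - B' w) (B' (Φ q) - B (Φ q))
    have := norm_sub_le (B' y) (B' w)
    have := hB' w hw
    have := hBd q
    linarith
  have hqn : ‖q‖ ≤ 2 * k * (‖B' y‖ + K * vHolNorm a b (n + r) α w) := by
    have e1 := (hκ' q).trans (mul_le_mul_of_nonneg_left hBq hκ0)
    have e2 := mul_le_mul_of_nonneg_right hδ1 (norm_nonneg q)
    linarith
  set N := vHolNorm a b (n + r) α y
  have hN0 : 0 ≤ N := vHolNorm_nonneg _ _ _ _ _
  set W := vHolNorm a b (n + r) α w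
  set F := vHolNorm a b n α (Lop a b r A' y)
  have hF0 : 0 ≤ F := vHolNorm_nonneg _ _ _ _ _
  have hb0 := norm_nonneg (B' y)
  have s1 : N ≤ M * W + 2 * k * C₁ * ‖B' y‖ := by
    have := mul_le_mul_of_nonneg_left hqn hC₁
    rw [hM]
    linarith
  have s2 : W ≤ C₁ * (F + C₂ * δ * N) := hNw.trans (mul_le_mul_of_nonneg_left hL0 hC₁)
  have s3 := mul_le_mul_of_nonneg_left s2 hM0
  have s4 := mul_le_mul_of_nonneg_right hδ2 hN0
  have s5 : N ≤ M * C₁ * F + P * δ * N + 2 * k * C₁ * ‖B' y‖ := by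
    rw [hP]; linarith
  have s6 : 0 ≤ M * C₁ * ‖B' y‖ := by positivity
  have s7 : 0 ≤ k * C₁ * F := by positivity
  linarith

lemma pi_decomp {r m : ℕ} (q : Fin r → Fin m → ℂ) :
    q = ∑ j, ∑ i, q j i • (Pi.single j (Pi.single i 1) : Fin r → Fin m → ℂ) := by
  ext j i
  simp only [Finset.sum_apply, Pi.smul_apply, smul_eq_mul]
  rw [Finset.sum_eq_single j]
  · rw [Finset.sum_eq_single i]
    · simp
    · intro i' _ h
      simp [Pi.single_apply, h.symm]
    · simp
  · intro j' _ h
    simp [Pi.single_apply, h.symm]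
  · simp

lemma eventually_close {r m : ℕ} {F : Type*} [NormedAddCommGroup F] [NormedSpace ℂ F]
    (T : ℝ → (Fin r → Fin m → ℂ) →ₗ[ℂ] F)
    (hT : ∀ q, Tendsto (fun ε => T ε q) (𝓝[>] 0) (𝓝 (T 0 q))) {δ : ℝ} (hδ : 0 < δ) :
    ∀ᶠ ε in 𝓝[>] (0 : ℝ), ∀ q, ‖T ε q - T 0 q‖ ≤ δ * ‖q‖ := by
  let e : Fin r → Fin m → (Fin r → Fin m → ℂ) := fun j i => Pi.single j (Pi.single i 1)
  have h1 : Tendsto (fun ε => ∑ j, ∑ i, ‖T ε (e j i) - T 0 (e j i)‖) (𝓝[>] 0) (𝓝 0) := by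
    have := tendsto_finsetSum (Finset.univ : Finset (Fin r)) fun j _ =>
      tendsto_finsetSum (Finset.univ : Finset (Fin m)) fun i _ =>
        tendsto_iff_norm_sub_tendsto_zero.1 (hT (e j i))
    simpa using this
  filter_upwards [h1.eventually (ge_mem_nhds hδ)] with ε hε q
  refine le_trans ?_ (mul_le_mul_of_nonneg_right hε (norm_nonneg q))
  have h2 : T ε q - T 0 q = ∑ j, ∑ i, q j i • (T ε (e j i) - T 0 (e j i)) := by
    conv_lhs => rw [pi_decomp q]
    simp only [map_sum, map_smul, smul_sub, Finset.sum_sub_distrib, e]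
  rw [h2, Finset.sum_mul]
  refine norm_sum_le_of_le _ fun j _ => ?_
  rw [Finset.sum_mul]
  refine norm_sum_le_of_le _ fun i _ => ?_
  rw [norm_smul, mul_comm]
  exact mul_le_mul_of_nonneg_left (norm_comp_le q j i) (norm_nonneg _)

lemma star_of_est {a b α : ℝ} (hab : a < b) (hα1 : α ≤ 1) {n r m : ℕ} (hr : 0 < r)
    {A : Fin r → ℝ → Matrix (Fin m) (Fin m) ℂ} (hA : ∀ j, mHolMem a b n α (A j))
    (B : (ℝ → (Fin m → ℂ)) →ₗ[ℂ] (Fin (r * m) → ℂ)) {C : ℝ}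
    (hest : ∀ y, vHolMem a b (n + r) α y →
        vHolNorm a b (n + r) α y ≤ C * (vHolNorm a b n α (Lop a b r A y) + ‖B y‖))
    {f : ℝ → Fin m → ℂ} (hf : vHolMem a b n α f) (c : Fin (r * m) → ℂ) :
    ∃ y, IsSol a b n α r m A B f c y ∧
      ∀ y', IsSol a b n α r m A B f c y' → EqOn y' y (Icc a b) := by
  have huniq : ∀ y, vHolMem a b (n + r) α y → (∀ t ∈ Icc a b, Lop a b r A y t = 0) → B y = 0 →
      ∀ t ∈ Icc a b, y t = 0 := by
    intro y hy hL hB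
    apply eq_zero_of_vHolNorm hy
    have := hest y hy
    rw [hB, vHolNorm_congr (y := 0) (fun t ht => hL t ht), vHolNorm_zero hab] at this
    simpa using this
  obtain ⟨Φ, hΦ⟩ := exists_fund hab hα1 hr hA
  obtain ⟨u, hu1, hu2, _⟩ := exists_ivp hab hα1 hr hA hf 0
  have hinj : Function.Injective (B ∘ₗ Φ) := by
    rw [← LinearMap.ker_eq_bot, LinearMap.ker_eq_bot']
    intro q hq
    rw [← (hΦ q).2.2]
    exact jet_zero_of hab (huniq _ (hΦ q).1 (hΦ q).2.1 hq)
  have hsurj : Function.Surjective (B ∘ₗ Φ) :=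
    (LinearMap.injective_iff_surjective_of_finrank_eq_finrank (by simp [Module.finrank_pi_fintype])).1 hinj
  obtain ⟨q, hq⟩ := hsurj (c - B u)
  obtain ⟨h1, h2, _⟩ := hΦ q
  have hsol : IsSol a b n α r m A B f c (u + Φ q) := by
    refine ⟨hu1.add hab h1, fun t ht => ?_, ?_⟩
    · have := Lop_lin hab A hu1 h1 1 ht
      rw [one_smul, one_smul, hu2 t ht, h2 t ht, add_zero] at this
      exact this
    · rw [map_add, show B (Φ q) = c - B u from hq]
      abel
  refine ⟨_, hsol, fun y' hy' t ht => ?_⟩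
  set y := u + Φ q
  have h3 : vHolMem a b (n + r) α (y' + (-1 : ℂ) • y) := hy'.1.add hab (hsol.1.smul hab _)
  have := huniq _ h3 (fun s hs => by
    rw [Lop_lin hab A hy'.1 hsol.1 _ hs, hy'.2.1 s hs, hsol.2.1 s hs]
    simp) (by rw [map_add, map_smul, hy'.2.2, hsol.2.2]; simp) t ht
  have h4 : y' t - y t = 0 := by simpa [sub_eq_add_neg] using this
  exact sub_eq_zero.1 h4

theorem main_theorem_sufficiency
    (a b : ℝ) (hab : a < b) (n : ℕ) (α : ℝ) (hα0 : 0 < α) (hα1 : α ≤ 1)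
    (m r : ℕ) (hm : 1 ≤ m) (hr : 2 ≤ r) (ε₀ : ℝ) (hε₀ : 0 < ε₀)
    (A : ℝ → Fin r → ℝ → Matrix (Fin m) (Fin m) ℂ)
    (hA : ∀ ε ∈ Set.Ico (0 : ℝ) ε₀, ∀ j, mHolMem a b n α (A ε j))
    (B : ℝ → (ℝ → (Fin m → ℂ)) →ₗ[ℂ] (Fin (r * m) → ℂ))
    (hB : ∀ ε ∈ Set.Ico (0 : ℝ) ε₀, ∃ K : ℝ, ∀ y : ℝ → (Fin m → ℂ),
      vHolMem a b (n + r) α y → ‖B ε y‖ ≤ K * vHolNorm a b (n + r) α y)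
    (hcond0 : Cond0 a b n α r m (A 0) (B 0))
    (hI : CondI a b n α r m A)
    (hII : CondII a b n α r m B) :
    ∃ ε₁ : ℝ, 0 < ε₁ ∧ ε₁ < ε₀ ∧
      CondStar a b n α r m ε₁ A B ∧ CondStarStar a b n α r m ε₁ A B := by
  have hr0 : 0 < r := by omega
  have h00 : (0 : ℝ) ∈ Ico (0 : ℝ) ε₀ := ⟨le_rfl, hε₀⟩
  have hA0 := hA 0 h00
  obtain ⟨Φ, hΦ⟩ := exists_fund hab hα1 hr0 hA0
  obtain ⟨K₀, hK₀⟩ := hB 0 h00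
  obtain ⟨K₁, hK₁⟩ := unif_bound hab B hε₀ hB hII
  have hK : 0 ≤ max |K₀| |K₁| := (abs_nonneg _).trans (le_max_left _ _)
  set K := max |K₀| |K₁|
  have hKK₀ : K₀ ≤ K := (le_abs_self _).trans (le_max_left _ _)
  have hKK₁ : K₁ ≤ K := (le_abs_self _).trans (le_max_right _ _)
  obtain ⟨δ, hδ, C, hC, hest⟩ := unif_est hab hα1 hr0 hA0 (B 0) hcond0 Φ hΦ hK
  have hsumI : Tendsto (fun ε => ∑ j, mHolNorm a b n α (fun t => A ε j t - A 0 j t))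
      (𝓝[>] 0) (𝓝 0) := by
    have := tendsto_finsetSum Finset.univ (fun j _ => hI j)
    simpa using this
  have hclose := eventually_close (fun ε => B ε ∘ₗ Φ) (fun q => hII _ (hΦ q).1) hδ
  have hgood : ∀ᶠ ε in 𝓝[>] (0 : ℝ), ε < ε₀ → ∀ y, vHolMem a b (n + r) α y →
      vHolNorm a b (n + r) α y ≤ C * (vHolNorm a b n α (Lop a b r (A ε) y) + ‖B ε y‖) := by
    filter_upwards [hK₁, hclose, hsumI.eventually (ge_mem_nhds hδ), self_mem_nhdsWithin]
      with ε e1 e2 e3 e4 e5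
    exact hest (A ε) (B ε) (hA ε ⟨(mem_Ioi.1 e4).le, e5⟩) (fun y hy => (e1 y hy).trans
      (mul_le_mul_of_nonneg_right hKK₁ (vHolNorm_nonneg _ _ _ _ _))) e3 e2
  have hgood0 := hest (A 0) (B 0) hA0 (fun y hy => (hK₀ y hy).trans
      (mul_le_mul_of_nonneg_right hKK₀ (vHolNorm_nonneg _ _ _ _ _))) (by
        have hz : mHolNorm a b n α (fun _ => (0 : Matrix (Fin m) (Fin m) ℂ)) = 0 := by
          refine Finset.sum_eq_zero fun i _ => ?_
          exact vHolNorm_zero hab n α m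
        simp only [sub_self, hz]
        simpa using hδ.le) (fun q => by
        rw [sub_self, norm_zero]
        positivity)
  obtain ⟨u, hu0, hu⟩ := mem_nhdsGT_iff_exists_Ioo_subset.1 hgood
  have hu0' : 0 < u := hu0
  have hE : ∀ ε ∈ Ico (0 : ℝ) (min u (ε₀ / 2)), ∀ y, vHolMem a b (n + r) α y →
      vHolNorm a b (n + r) α y ≤ C * (vHolNorm a b n α (Lop a b r (A ε) y) + ‖B ε y‖) := by
    intro ε hε
    have h1 := hε.2.trans_le (min_le_left _ _)
    have h2 := hε.2.trans_le (min_le_right _ _)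
    rcases hε.1.eq_or_lt with h | h
    · rw [← h]
      exact hgood0
    · exact hu ⟨h, h1⟩ (by linarith)
  have hε1 : 0 < min u (ε₀ / 2) := by positivity
  have hlt : min u (ε₀ / 2) < ε₀ := (min_le_right _ _).trans_lt (by linarith)
  refine ⟨min u (ε₀ / 2), hε1, hlt, ?_, ?_⟩
  · intro ε hε f hf c
    exact star_of_est hab hα1 hr0 (hA ε ⟨hε.1, hε.2.trans hlt⟩) (B ε) (hE ε hε) hf c
  · intro f c y hy hf hc
    obtain ⟨hf0, hy0⟩ := hy 0 ⟨le_rfl, hε1⟩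
    obtain ⟨C₂, hC₂, h₂⟩ := low_est hab hα1 n r m
    have hlim : Tendsto (fun ε => C * ((vHolNorm a b n α (fun t => f ε t - f 0 t) +
        C₂ * (∑ j, mHolNorm a b n α (fun t => A ε j t - A 0 j t)) * vHolNorm a b (n + r) α (y 0)) +
        ‖c ε - B ε (y 0)‖)) (𝓝[>] 0) (𝓝 0) := by
      have e1 : Tendsto (fun ε => ‖c ε - B ε (y 0)‖) (𝓝[>] 0) (𝓝 0) := by
        have := (hc.sub (hII _ hy0.1)).norm
        rw [hy0.2.2, sub_self, norm_zero] at this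
        exact this
      have := (((hf.add ((hsumI.const_mul C₂).mul_const (vHolNorm a b (n + r) α (y 0)))).add e1).const_mul C)
      simpa using this
    refine squeeze_zero' (Eventually.of_forall fun ε => vHolNorm_nonneg _ _ _ _ _) ?_ hlim
    filter_upwards [Ioo_mem_nhdsGT hε1] with ε hε
    have hε' : ε ∈ Ico 0 (min u (ε₀ / 2)) := ⟨hε.1.le, hε.2⟩
    have hAε := hA ε ⟨hε'.1, hε.2.trans hlt⟩
    obtain ⟨hfε, hyε⟩ := hy ε hε'
    have hd : (fun t => y ε t - y 0 t) = y ε + (-1 : ℂ) • y 0 := by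
      ext t i
      simp [sub_eq_add_neg]
    rw [hd]
    refine (hE ε hε' _ (hyε.1.add hab (hy0.1.smul hab _))).trans (mul_le_mul_of_nonneg_left ?_ hC)
    have hlow := h₂ (fun j t => A ε j t - A 0 j t) (fun j i l =>
      ((hAε j i l).sub hab (hA0 j i l)).1) (y 0) hy0.1
    refine add_le_add ?_ ?_
    · have e : EqOn (Lop a b r (A ε) (y ε + (-1 : ℂ) • y 0)) ((fun t => f ε t - f 0 t) -
          fun t => ∑ j : Fin r, (A ε j t - A 0 j t).mulVec (vDeriv a b (j : ℕ) (y 0) t)) (Icc a b) := by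
        intro t ht
        rw [Lop_lin hab _ hyε.1 hy0.1 _ ht, hyε.2.1 t ht]
        have h3 := congrFun (Lop_diff (a := a) (b := b) (A 0) (A ε) (y 0)) t
        rw [hy0.2.1 t ht] at h3
        simp only [Pi.sub_apply] at h3 ⊢
        rw [h3]
        simp
        abel
      rw [vHolNorm_congr e]
      exact (vHolNorm_sub_le hab (hfε.sub hab hf0) hlow.1).trans (add_le_add le_rfl hlow.2)
    · rw [map_add, map_smul, hyε.2.2]
      simp [sub_eq_add_neg]
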